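/- arXiv:2508.01748 — 4 statements merged into one kernel-verified Lean document; each statement's English description precedes it below -/
import Mathlib

section
/- Let F be a field. If there exists an ⟨m,n,p;t⟩-algorithm over F, then, setting r = m·n·p, there exists an ⟨r,r,r;t³⟩-algorithm over F. -/
open Matrix

/-- Row-major vectorization: `vec A (n*i+j) = A i j`. -/
def vec {F : Type*} {m n : ℕ} (A : Matrix (Fin m) (Fin n) F) : Fin (m * n) → F :=
  fun r => A r.divNat r.modNat

/-- `⟨U, V, W⟩` is an `⟨m, n, p; t⟩`-algorithm over `F`: for all `A, B, C` of the appropriate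
sizes, `trace (A * B * C) = ∑ r, (U ⬝ᵥ vec A) r * (V ⬝ᵥ vec B) r * (W ⬝ᵥ vec C) r`. -/
def IsMMAlg {F : Type*} [Field F] (m n p t : ℕ)
    (U : Matrix (Fin t) (Fin (m * n)) F)
    (V : Matrix (Fin t) (Fin (n * p)) F)
    (W : Matrix (Fin t) (Fin (p * m)) F) : Prop :=
  ∀ (A : Matrix (Fin m) (Fin n) F) (B : Matrix (Fin n) (Fin p) F) (C : Matrix (Fin p) (Fin m) F),
    (A * B * C).trace =
      ∑ r : Fin t, U.mulVec (vec A) r * V.mulVec (vec B) r * W.mulVec (vec C) r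

/-- Coordinate (tensor) form of a matrix multiplication algorithm, over arbitrary index types. -/
def TensorAlg (F : Type*) [Field F] (α β γ τ : Type) [Fintype τ] : Prop :=
  ∃ (u : τ → α → β → F) (v : τ → β → γ → F) (w : τ → γ → α → F),
    ∀ (i i' : α) (j j' : β) (k k' : γ), (j = j' ∧ k = k' ∧ i = i' → 
      ∑ r, u r i j * v r j' k * w r k' i' = 1) ∧
      (¬ (j = j' ∧ k = k' ∧ i = i') → ∑ r, u r i j * v r j' k * w r k' i' = 0)

theorem TensorAlg.rot {F : Type*} [Field F] {α β γ τ : Type} [Fintype τ]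
    (h : TensorAlg F α β γ τ) : TensorAlg F β γ α τ := by
  obtain ⟨u, v, w, h⟩ := h
  refine ⟨v, w, u, fun j j' k k' i i' => ?_⟩
  have e : ∑ r, v r j k * w r k' i * u r i' j' = ∑ r, u r i' j' * v r j k * w r k' i :=
    Finset.sum_congr rfl fun r _ => by ring
  rw [e]
  have := h i' i j' j k k'
  exact ⟨fun hh => this.1 ⟨hh.2.2.symm, hh.1, hh.2.1.symm⟩,
    fun hh => this.2 fun h3 => hh ⟨h3.2.1, h3.2.2.symm, h3.1.symm⟩⟩

theorem TensorAlg.prod {F : Type*} [Field F] {α β γ τ α' β' γ' τ' : Type} [Fintype τ] [Fintype τ']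
    (h : TensorAlg F α β γ τ) (h' : TensorAlg F α' β' γ' τ') :
    TensorAlg F (α × α') (β × β') (γ × γ') (τ × τ') := by
  obtain ⟨u, v, w, h⟩ := h
  obtain ⟨u', v', w', h'⟩ := h'
  refine ⟨fun r i j => u r.1 i.1 j.1 * u' r.2 i.2 j.2, fun r i j => v r.1 i.1 j.1 * v' r.2 i.2 j.2,
    fun r i j => w r.1 i.1 j.1 * w' r.2 i.2 j.2, fun i i' j j' k k' => ?_⟩
  have e : ∑ r : τ × τ', (u r.1 i.1 j.1 * u' r.2 i.2 j.2) * (v r.1 j'.1 k.1 * v' r.2 j'.2 k.2) *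
      (w r.1 k'.1 i'.1 * w' r.2 k'.2 i'.2) =
      (∑ r, u r i.1 j.1 * v r j'.1 k.1 * w r k'.1 i'.1) *
      (∑ r, u' r i.2 j.2 * v' r j'.2 k.2 * w' r k'.2 i'.2) := by
    rw [Finset.sum_mul_sum, Fintype.sum_prod_type]
    exact Finset.sum_congr rfl fun r _ => Finset.sum_congr rfl fun s _ => by ring
  rw [e]
  have h1 := h i.1 i'.1 j.1 j'.1 k.1 k'.1
  have h2 := h' i.2 i'.2 j.2 j'.2 k.2 k'.2
  constructor
  · rintro ⟨rfl, rfl, rfl⟩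
    rw [h1.1 ⟨rfl, rfl, rfl⟩, h2.1 ⟨rfl, rfl, rfl⟩, one_mul]
  · intro hn
    by_cases c : j.1 = j'.1 ∧ k.1 = k'.1 ∧ i.1 = i'.1
    · rw [h2.2, mul_zero]
      intro d
      exact hn ⟨Prod.ext c.1 d.1, Prod.ext c.2.1 d.2.1, Prod.ext c.2.2 d.2.2⟩
    · rw [h1.2 c, zero_mul]

theorem TensorAlg.reindex {F : Type*} [Field F] {α β γ τ α' β' γ' τ' : Type}
    [Fintype τ] [Fintype τ'] (ea : α' ≃ α) (eb : β' ≃ β) (ec : γ' ≃ γ) (et : τ' ≃ τ)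
    (h : TensorAlg F α β γ τ) : TensorAlg F α' β' γ' τ' := by
  obtain ⟨u, v, w, h⟩ := h
  refine ⟨fun r i j => u (et r) (ea i) (eb j), fun r i j => v (et r) (eb i) (ec j),
    fun r i j => w (et r) (ec i) (ea j), fun i i' j j' k k' => ?_⟩
  rw [et.sum_comp (fun r => u r (ea i) (eb j) * v r (eb j') (ec k) * w r (ec k') (ea i'))]
  have := h (ea i) (ea i') (eb j) (eb j') (ec k) (ec k')
  simpa only [EmbeddingLike.apply_eq_iff_eq] using this

theorem mulVec_vec_eq {F : Type*} [Field F] {m n t : ℕ} (U : Matrix (Fin t) (Fin (m * n)) F)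
    (A : Matrix (Fin m) (Fin n) F) (r : Fin t) :
    U.mulVec (_root_.vec A) r = ∑ x : Fin m × Fin n, U r (finProdFinEquiv x) * A x.1 x.2 := by
  rw [Matrix.mulVec, dotProduct, ← finProdFinEquiv.sum_comp]
  refine Finset.sum_congr rfl fun x _ => ?_
  have hx : finProdFinEquiv.symm (finProdFinEquiv x) = x := finProdFinEquiv.symm_apply_apply x
  have h1 : (finProdFinEquiv x).divNat = x.1 := congrArg Prod.fst hx
  have h2 : (finProdFinEquiv x).modNat = x.2 := congrArg Prod.snd hx
  rw [_root_.vec, h1, h2]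

theorem mulVec_vec_single {F : Type*} [Field F] {m n t : ℕ} (U : Matrix (Fin t) (Fin (m * n)) F)
    (i : Fin m) (j : Fin n) (r : Fin t) :
    U.mulVec (_root_.vec (Matrix.single i j (1 : F))) r = U r (finProdFinEquiv (i, j)) := by
  rw [mulVec_vec_eq, Finset.sum_eq_single (i, j)]
  · simp
  · rintro ⟨a, b⟩ _ hne
    have : ¬ (i = a ∧ j = b) := fun hh => hne (by rw [hh.1, hh.2])
    simp [Matrix.single_apply, this]
  · simp

theorem tensorAlg_of_isMMAlg {F : Type*} [Field F] {m n p t : ℕ}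
    {U : Matrix (Fin t) (Fin (m * n)) F} {V : Matrix (Fin t) (Fin (n * p)) F}
    {W : Matrix (Fin t) (Fin (p * m)) F} (h : IsMMAlg m n p t U V W) :
    TensorAlg F (Fin m) (Fin n) (Fin p) (Fin t) := by
  refine ⟨fun r i j => U r (finProdFinEquiv (i, j)), fun r i j => V r (finProdFinEquiv (i, j)),
    fun r i j => W r (finProdFinEquiv (i, j)), fun i i' j j' k k' => ?_⟩
  have := h (Matrix.single i j 1) (Matrix.single j' k 1) (Matrix.single k' i' 1)
  simp only [mulVec_vec_single] at this
  rw [← this]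
  constructor
  · rintro ⟨rfl, rfl, rfl⟩
    simp
  · intro hn
    by_cases hj : j = j'
    · subst hj
      by_cases hk : k = k'
      · subst hk
        have hi : i ≠ i' := fun hi => hn ⟨rfl, rfl, hi⟩
        simp [Matrix.trace_single_eq_of_ne, hi]
      · simp [hk]
    · simp [hj]

theorem isMMAlg_of_tensorAlg {F : Type*} [Field F] {m n p t : ℕ}
    (h : TensorAlg F (Fin m) (Fin n) (Fin p) (Fin t)) :
    ∃ (U : Matrix (Fin t) (Fin (m * n)) F) (V : Matrix (Fin t) (Fin (n * p)) F)
      (W : Matrix (Fin t) (Fin (p * m)) F), IsMMAlg m n p t U V W := by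
  obtain ⟨u, v, w, h⟩ := h
  refine ⟨Matrix.of fun r x => u r (finProdFinEquiv.symm x).1 (finProdFinEquiv.symm x).2,
    Matrix.of fun r x => v r (finProdFinEquiv.symm x).1 (finProdFinEquiv.symm x).2,
    Matrix.of fun r x => w r (finProdFinEquiv.symm x).1 (finProdFinEquiv.symm x).2, fun A B C => ?_⟩
  simp only [mulVec_vec_eq, Matrix.of_apply, Equiv.symm_apply_apply]
  have key : ∀ (x : Fin m × Fin n) (y : Fin n × Fin p) (z : Fin p × Fin m),
      ∑ r, u r x.1 x.2 * v r y.1 y.2 * w r z.1 z.2 =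
        if x.2 = y.1 then if y.2 = z.1 then if x.1 = z.2 then 1 else 0 else 0 else 0 := by
    intro x y z
    have := h x.1 z.2 x.2 y.1 y.2 z.1
    split_ifs with h1 h2 h3
    · exact this.1 ⟨h1, h2, h3⟩
    · exact this.2 fun hh => h3 hh.2.2
    · exact this.2 fun hh => h2 hh.2.1
    · exact this.2 fun hh => h1 hh.1
  have e : ∑ r, (∑ x : Fin m × Fin n, u r x.1 x.2 * A x.1 x.2) *
      (∑ x : Fin n × Fin p, v r x.1 x.2 * B x.1 x.2) *
      (∑ x : Fin p × Fin m, w r x.1 x.2 * C x.1 x.2) =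
      ∑ x : Fin m × Fin n, ∑ y : Fin n × Fin p, ∑ z : Fin p × Fin m,
        (∑ r, u r x.1 x.2 * v r y.1 y.2 * w r z.1 z.2) * (A x.1 x.2 * B y.1 y.2 * C z.1 z.2) := by
    simp only [Finset.sum_mul_sum]
    simp only [Finset.sum_mul]
    rw [Finset.sum_comm]
    refine Finset.sum_congr rfl fun x _ => ?_
    conv_rhs => rw [Finset.sum_comm]
    rw [Finset.sum_comm]
    refine Finset.sum_congr rfl fun z _ => ?_
    rw [Finset.sum_comm]
    exact Finset.sum_congr rfl fun y _ => Finset.sum_congr rfl fun r _ => by ring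
  rw [e]
  simp only [key]
  simp only [Fintype.sum_prod_type, ite_mul, one_mul, zero_mul, Finset.sum_ite_eq,
    Finset.sum_ite_irrel, Finset.sum_const_zero, Finset.mem_univ, if_true,
    Matrix.trace, Matrix.diag, Matrix.mul_apply, Finset.sum_mul]
  refine Finset.sum_congr rfl fun i _ => ?_
  rw [Finset.sum_comm]

/-- Symmetrization: an `⟨m,n,p;t⟩`-algorithm yields an `⟨r,r,r;t³⟩`-algorithm for
`r = m * n * p`. -/
theorem isMMAlg_symmetrization {F : Type*} [Field F] (m n p t : ℕ)
    (h : ∃ (U : Matrix (Fin t) (Fin (m * n)) F) (V : Matrix (Fin t) (Fin (n * p)) F)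
      (W : Matrix (Fin t) (Fin (p * m)) F), IsMMAlg m n p t U V W) :
    ∃ (U V W : Matrix (Fin (t ^ 3)) (Fin ((m * n * p) * (m * n * p))) F),
      IsMMAlg (m * n * p) (m * n * p) (m * n * p) (t ^ 3) U V W := by
  obtain ⟨U, V, W, h⟩ := h
  have T := tensorAlg_of_isMMAlg h
  have T3 := (T.prod T.rot).prod T.rot.rot
  refine isMMAlg_of_tensorAlg (T3.reindex (Fintype.equivOfCardEq ?_) (Fintype.equivOfCardEq ?_)
    (Fintype.equivOfCardEq ?_) (Fintype.equivOfCardEq ?_)) <;>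
  simp only [Fintype.card_prod, Fintype.card_fin] <;> ring
end

section
/- For every even natural number n₀ ≥ 2 with n₀ ≠ 16, there exists an ⟨n₀,n₀,n₀;t⟩-algorithm over ℚ, where t = (4·n₀³ + 45·n₀² + 122·n₀ + 96)/12, i.e. t is the natural number satisfying 12·t = 4·n₀³ + 45·n₀² + 122·n₀ + 96. -/
open Matrix

/-- `Rk t f`: the trilinear form `f` is a sum of `t` products of linear functionals. -/
def Rk {V : Type} [AddCommGroup V] [Module ℚ V] (t : ℕ) (f : V → V → V → ℚ) : Prop :=
  ∃ u v w : Fin t → (V →ₗ[ℚ] ℚ), ∀ A B C, f A B C = ∑ r, u r A * v r B * w r C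

section rank
variable {V : Type} [AddCommGroup V] [Module ℚ V]

theorem Rk.zero : Rk 0 (fun _ _ _ : V => (0 : ℚ)) :=
  ⟨fun _ => 0, fun _ => 0, fun _ => 0, by simp⟩

theorem Rk.congr {t : ℕ} {f g : V → V → V → ℚ} (h : Rk t f) (e : ∀ A B C, g A B C = f A B C) :
    Rk t g := by
  obtain ⟨u, v, w, h⟩ := h
  exact ⟨u, v, w, fun A B C => (e A B C).trans (h A B C)⟩

theorem Rk.one (u v w : V →ₗ[ℚ] ℚ) : Rk 1 (fun A B C => u A * v B * w C) :=
  ⟨fun _ => u, fun _ => v, fun _ => w, by simp⟩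

theorem Rk.add {s t : ℕ} {f g : V → V → V → ℚ} (hf : Rk s f) (hg : Rk t g) :
    Rk (s + t) (fun A B C => f A B C + g A B C) := by
  obtain ⟨u, v, w, h⟩ := hf
  obtain ⟨u', v', w', h'⟩ := hg
  refine ⟨Fin.append u u', Fin.append v v', Fin.append w w', fun A B C => ?_⟩
  rw [Fin.sum_univ_add]
  simp [h, h']

theorem Rk.sum {ι : Type} (s : Finset ι) {t : ℕ} {f : ι → V → V → V → ℚ}
    (hf : ∀ i, Rk t (f i)) : Rk (s.card * t) (fun A B C => ∑ i ∈ s, f i A B C) := by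
  classical
  induction s using Finset.induction_on with
  | empty => simpa using Rk.zero
  | insert a s ha ih =>
    rw [Finset.card_insert_of_notMem ha, Nat.add_mul, Nat.one_mul, Nat.add_comm]
    refine ((hf a).add ih).congr fun A B C => ?_
    rw [Finset.sum_insert ha]

/-- weighted, signed `2 × 2` matrix multiplication form -/
def Wt (p q a00 a01 a10 a11 b00 b01 b10 b11 c00 c01 c10 c11 : ℚ) : ℚ :=
  p * (a00 * b00 * c00 + a11 * b11 * c11)
  + q * (-(a00 * b10 * c01) - a10 * b01 * c00 + a01 * b00 * c10
    - a11 * b01 * c10 - a01 * b10 * c11 + a10 * b11 * c01)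

theorem strassen (x00 x01 x10 x11 y00 y01 y10 y11 z00 z01 z10 z11 : ℚ) :
    (x00 + x11) * (z00 + z11) * (y00 + y11)
    + (x10 + x11) * (z01 - z11) * y00
    + x00 * (z10 + z11) * (y01 - y11)
    + x11 * (z00 + z01) * (y10 - y00)
    + (x00 + x01) * (z10 - z00) * y11
    + (x10 - x00) * z11 * (y00 + y01)
    + (x01 - x11) * z00 * (y10 + y11) =
    x00 * y00 * z00 + x00 * y01 * z10 + x01 * y10 * z00 + x01 * y11 * z10
    + x10 * y00 * z01 + x10 * y01 * z11 + x11 * y10 * z01 + x11 * y11 * z11 := by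
  ring

/-- Strassen-type decomposition whose first product absorbs a further product
with coefficient `e`. -/
theorem Rk.seven (p q e : ℚ) (hp : p ≠ 0) (hq : q ≠ 0)
    (a00 a01 a10 a11 b00 b01 b10 b11 c00 c01 c10 c11 : V →ₗ[ℚ] ℚ) :
    Rk 7 (fun A B C => Wt p q (a00 A) (a01 A) (a10 A) (a11 A) (b00 B) (b01 B) (b10 B) (b11 B)
      (c00 C) (c01 C) (c10 C) (c11 C)
      + e * ((a00 A + a10 A + a01 A) * (b01 B + b00 B - b10 B) * (c10 C + c01 C - c00 C))) := by
  let r : ℚ := q / p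
  let x00 := a00 + a10
  let x01 := r • a01 + a11
  let x10 := r⁻¹ • a00
  let x11 := a01
  let n00 := b00 - b10
  let n01 := b11 - r • b01
  let n10 := -(r⁻¹ • b00)
  let n11 := b01
  let z00 := n01 + n11
  let z01 := r • (n00 - n01 + n10 - n11)
  let z10 := r⁻¹ • n01
  let z11 := n00 - n01
  let k00 := q • c01
  let k01 := (q * r) • c01 - q • c00
  let k10 := p • c11
  let k11 := q • c11 - q • c10
  let y00 := k01
  let y01 := r • (k00 - k01)
  let y10 := k11
  let y11 := r • (k10 - k11)
  have h := ((((((Rk.one (x00 + x11) (z00 + z11) (y00 + y11 + e • (c10 + c01 - c00))).add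
    (Rk.one (x10 + x11) (z01 - z11) y00)).add
    (Rk.one x00 (z10 + z11) (y01 - y11))).add
    (Rk.one x11 (z00 + z01) (y10 - y00))).add
    (Rk.one (x00 + x01) (z10 - z00) y11)).add
    (Rk.one (x10 - x00) z11 (y00 + y01))).add
    (Rk.one (x01 - x11) z00 (y10 + y11))
  refine h.congr fun A B C => ?_
  have hs := strassen (x00 A) (x01 A) (x10 A) (x11 A) (y00 C) (y01 C) (y10 C) (y11 C)
    (z00 B) (z01 B) (z10 B) (z11 B)
  have h1 : ∀ u v w d S1 S2 S3 S4 S5 S6 T : ℚ, u * v * w + S1 + S2 + S3 + S4 + S5 + S6 = T →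
    u * v * (w + d) + S1 + S2 + S3 + S4 + S5 + S6 = T + u * v * d := by
    intros; subst_vars; ring
  have h2 := h1 _ _ _ (e * (c10 C + c01 C - c00 C)) _ _ _ _ _ _ _ hs
  simp only [LinearMap.add_apply, LinearMap.sub_apply, LinearMap.smul_apply, smul_eq_mul]
  refine Eq.trans ?_ h2.symm
  simp only [x00, x01, x10, x11, y00, y01, y10, y11, z00, z01, z10, z11, n00, n01, n10, n11,
    k00, k01, k10, k11, LinearMap.add_apply, LinearMap.sub_apply, LinearMap.smul_apply,
    LinearMap.neg_apply, smul_eq_mul, Wt, r, inv_div]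
  field_simp
  ring

end rank

section agg
variable {S : ℕ}

theorem rot (f : Fin S → Fin S → Fin S → ℚ) :
    ∑ i, ∑ j, ∑ k, f j k i = ∑ i, ∑ j, ∑ k, f i j k := by
  calc ∑ i, ∑ j, ∑ k, f j k i = ∑ j, ∑ i, ∑ k, f j k i := Finset.sum_comm
    _ = _ := Finset.sum_congr rfl fun j _ => Finset.sum_comm

theorem agg_one (A B B' B'' C C' C'' : Fin S → Fin S → ℚ)
    (hA : ∀ j, ∑ i, A i j = 0) (hA' : ∀ i, ∑ j, A i j = 0)
    (hB : ∀ i, ∑ j, B i j = 0) (hB' : ∀ j, ∑ i, B' i j = 0)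
    (hC : ∀ j, ∑ i, C i j = 0) (hC'' : ∀ i, ∑ j, C'' i j = 0) :
    ∑ i, ∑ j, ∑ k, A i j * (B j k + B' k i + B'' i j) * (C k i + C' i j + C'' j k) =
    ∑ i, ∑ j, ∑ k, A i j * B j k * C k i + ∑ i, ∑ j, ∑ k, A i j * B' k i * C'' j k
    + S * ∑ i, ∑ j, A i j * B'' i j * C' i j := by
  have e1 : ∑ i, ∑ j, ∑ k, A i j * B j k * C' i j = 0 := by
    simp only [← Finset.mul_sum, ← Finset.sum_mul, hB]; simp
  have e2 : ∑ i, ∑ j, ∑ k, A i j * B j k * C'' j k = 0 := by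
    rw [← rot]
    rw [← rot]
    simp only [mul_assoc, ← Finset.sum_mul, hA]; simp
  have e3 : ∑ i, ∑ j, ∑ k, A i j * B' k i * C k i = 0 := by
    rw [← rot]
    simp only [mul_assoc, ← Finset.sum_mul]
    simp [hA']
  have e4 : ∑ i, ∑ j, ∑ k, A i j * B' k i * C' i j = 0 := by
    simp only [← Finset.mul_sum, ← Finset.sum_mul, hB']; simp
  have e5 : ∑ i, ∑ j, ∑ k, A i j * B'' i j * C k i = 0 := by
    simp only [← Finset.mul_sum, hC]; simp
  have e6 : ∑ i, ∑ j, ∑ k, A i j * B'' i j * C'' j k = 0 := by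
    simp only [← Finset.mul_sum, hC'']; simp
  have e7 : ∑ i, ∑ j, ∑ _k : Fin S, A i j * B'' i j * C' i j
      = S * ∑ i, ∑ j, A i j * B'' i j * C' i j := by
    simp [Finset.mul_sum]
  have : ∀ i j k, A i j * (B j k + B' k i + B'' i j) * (C k i + C' i j + C'' j k) =
    A i j * B j k * C k i + A i j * B' k i * C'' j k + A i j * B'' i j * C' i j
    + A i j * B j k * C' i j + A i j * B j k * C'' j k + A i j * B' k i * C k i
    + A i j * B' k i * C' i j + A i j * B'' i j * C k i + A i j * B'' i j * C'' j k := by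
    intros; ring
  simp only [this, Finset.sum_add_distrib, e1, e2, e3, e4, e5, e6, e7]
  ring

/-- zero row and column sums -/
def ZS (A : Fin S → Fin S → ℚ) : Prop := (∀ j, ∑ i, A i j = 0) ∧ (∀ i, ∑ j, A i j = 0)

theorem ZS.neg {A : Fin S → Fin S → ℚ} (h : ZS A) : ZS (fun i j => - A i j) :=
  ⟨fun j => by simp [h.1 j], fun j => by simp [h.2 j]⟩

/-- aggregate -/
def Ag (A B C A' B' C' A'' B'' C'' : Fin S → Fin S → ℚ) (i j k : Fin S) : ℚ :=
  (A i j + A' j k + A'' k i) * (B j k + B' k i + B'' i j) * (C k i + C' i j + C'' j k)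

/-- good term -/
def Gd (A B C : Fin S → Fin S → ℚ) : ℚ := ∑ i, ∑ j, ∑ k, A i j * B j k * C k i
/-- bad term -/
def Bd (A B C : Fin S → Fin S → ℚ) : ℚ := ∑ i, ∑ j, ∑ k, A i j * B k i * C j k
/-- correction term -/
def Co (A B C : Fin S → Fin S → ℚ) : ℚ := ∑ i, ∑ j, A i j * B i j * C i j

theorem agg_all {A B C A' B' C' A'' B'' C'' : Fin S → Fin S → ℚ}
    (hA : ZS A) (hB : ZS B) (hC : ZS C) (hA' : ZS A') (hB' : ZS B') (hC' : ZS C')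
    (hA'' : ZS A'') (hB'' : ZS B'') (hC'' : ZS C'') :
    ∑ i, ∑ j, ∑ k, Ag A B C A' B' C' A'' B'' C'' i j k =
    Gd A B C + Gd A' B' C' + Gd A'' B'' C''
    + Bd A B' C'' + Bd A' B'' C + Bd A'' B C'
    + S * (Co A B'' C' + Co A' B C'' + Co A'' B' C) := by
  have f1 := agg_one A B B' B'' C C' C'' hA.1 hA.2 hB.2 hB'.1 hC.1 hC''.2
  have f2 := agg_one A' B' B'' B C' C'' C hA'.1 hA'.2 hB'.2 hB''.1 hC'.1 hC.2
  have f3 := agg_one A'' B'' B B' C'' C C' hA''.1 hA''.2 hB''.2 hB.1 hC''.1 hC'.2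
  have g2 := rot (fun i j k => A' i j * (B' j k + B'' k i + B i j) * (C' k i + C'' i j + C j k))
  have g3' := rot (fun j k i => A'' i j * (B'' j k + B k i + B' i j) * (C'' k i + C i j + C' j k))
  have : ∀ i j k, Ag A B C A' B' C' A'' B'' C'' i j k =
     A i j * (B j k + B' k i + B'' i j) * (C k i + C' i j + C'' j k) +
     A' j k * (B' k i + B'' i j + B j k) * (C' i j + C'' j k + C k i) +
     A'' k i * (B'' i j + B j k + B' k i) * (C'' j k + C k i + C' i j) := by
    intros; unfold Ag; ring
  simp only [this, Finset.sum_add_distrib, Gd, Bd, Co]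
  rw [f1]
  have f2' := g2.trans f2
  have f3' := g3'.symm.trans f3
  rw [f2', f3']
  ring

/-- triples that are not constant -/
def ND (S : ℕ) : Finset (Fin S × Fin S × Fin S) :=
  Finset.univ.filter fun x => ¬ (x.1 = x.2.1 ∧ x.2.1 = x.2.2)

/-- representatives of non-constant triples up to rotation -/
def PP (S : ℕ) : Finset (Fin S × Fin S × Fin S) :=
  Finset.univ.filter fun x => x.1 ≤ x.2.1 ∧ x.1 < x.2.2

/-- off-diagonal pairs -/
def OD (S : ℕ) : Finset (Fin S × Fin S) := Finset.univ.filter fun x => ¬ x.1 = x.2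

theorem sum_ND (f : Fin S → Fin S → Fin S → ℚ) :
    ∑ i, ∑ j, ∑ k, f i j k = ∑ x ∈ ND S, f x.1 x.2.1 x.2.2 + ∑ i, f i i i := by
  have h : ∑ i, f i i i = ∑ i, ∑ j, ∑ k, if i = j ∧ j = k then f i j k else 0 := by
    refine Finset.sum_congr rfl fun i _ => ?_
    simp [ite_and]
  rw [h, ND, Finset.sum_filter, Fintype.sum_prod_type]
  simp only [Fintype.sum_prod_type, ← Finset.sum_add_distrib]
  refine Finset.sum_congr rfl fun i _ => Finset.sum_congr rfl fun j _ =>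
    Finset.sum_congr rfl fun k _ => ?_
  by_cases h : i = j ∧ j = k <;> simp [h]

theorem sum_PP (f : Fin S → Fin S → Fin S → ℚ) (hf : ∀ i j k, f j k i = f i j k) :
    ∑ x ∈ ND S, f x.1 x.2.1 x.2.2 = 3 * ∑ x ∈ PP S, f x.1 x.2.1 x.2.2 := by
  rw [ND, PP, Finset.sum_filter, Finset.sum_filter, Fintype.sum_prod_type, Fintype.sum_prod_type]
  simp only [Fintype.sum_prod_type]
  have h1 := rot (fun i j k : Fin S => if i ≤ j ∧ i < k then f i j k else 0)
  have h2 := rot (fun i j k : Fin S => if j ≤ k ∧ j < i then f j k i else 0)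
  have h3 : (∑ i : Fin S, ∑ j : Fin S, ∑ k : Fin S, if ¬ (i = j ∧ j = k) then f i j k else 0) =
      (∑ i : Fin S, ∑ j : Fin S, ∑ k : Fin S, if i ≤ j ∧ i < k then f i j k else 0)
      + (∑ i : Fin S, ∑ j : Fin S, ∑ k : Fin S, if j ≤ k ∧ j < i then f j k i else 0)
      + (∑ i : Fin S, ∑ j : Fin S, ∑ k : Fin S, if k ≤ i ∧ k < j then f k i j else 0) := by
    simp only [← Finset.sum_add_distrib]
    refine Finset.sum_congr rfl fun i _ => Finset.sum_congr rfl fun j _ =>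
      Finset.sum_congr rfl fun k _ => ?_
    rw [hf i j k, ← hf k i j]
    rcases lt_trichotomy i j with h | h | h <;> rcases lt_trichotomy j k with h' | h' | h' <;>
      rcases lt_trichotomy i k with h'' | h'' | h'' <;> grind
  rw [h3, h2, h1]
  ring

theorem sum_OD (f : Fin S → Fin S → ℚ) :
    ∑ i, ∑ j, f i j = ∑ x ∈ OD S, f x.1 x.2 + ∑ i, f i i := by
  have h : ∑ i, f i i = ∑ i, ∑ j, if i = j then f i j else 0 := by simp
  rw [h, OD, Finset.sum_filter, Fintype.sum_prod_type]
  simp only [← Finset.sum_add_distrib]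
  refine Finset.sum_congr rfl fun i _ => Finset.sum_congr rfl fun j _ => ?_
  by_cases h : i = j <;> simp [h]

theorem card_ND : (ND S).card + S = S ^ 3 := by
  have := sum_ND (fun _ _ _ : Fin S => (1 : ℚ))
  simp at this
  have h : (((ND S).card + S : ℕ) : ℚ) = ((S ^ 3 : ℕ) : ℚ) := by
    push_cast; rw [← this]; ring
  exact_mod_cast h

theorem card_PP : 3 * (PP S).card = (ND S).card := by
  have := sum_PP (fun _ _ _ : Fin S => (1 : ℚ)) (by simp)
  simp at this
  exact_mod_cast this.symm

theorem card_OD : (OD S).card + S = S ^ 2 := by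
  have := sum_OD (fun _ _ : Fin S => (1 : ℚ))
  simp at this
  have h : (((OD S).card + S : ℕ) : ℚ) = ((S ^ 2 : ℕ) : ℚ) := by
    push_cast; rw [← this]; ring
  exact_mod_cast h

theorem Bd_neg2 (A B C : Fin S → Fin S → ℚ) : Bd A (fun i j => - B i j) C = - Bd A B C := by
  simp [Bd]
theorem Bd_neg3 (A B C : Fin S → Fin S → ℚ) : Bd A B (fun i j => - C i j) = - Bd A B C := by
  simp [Bd]
theorem Gd_neg (A B C : Fin S → Fin S → ℚ) :
    Gd A (fun i j => - B i j) (fun i j => - C i j) = Gd A B C := by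
  simp [Gd]
theorem Co_neg2 (A B C : Fin S → Fin S → ℚ) : Co A (fun i j => - B i j) C = - Co A B C := by
  simp [Co]
theorem Co_neg3 (A B C : Fin S → Fin S → ℚ) : Co A B (fun i j => - C i j) = - Co A B C := by
  simp [Co]

theorem main_id {a00 a01 a10 a11 b00 b01 b10 b11 c00 c01 c10 c11 : Fin S → Fin S → ℚ}
    (ha00 : ZS a00) (ha01 : ZS a01) (ha10 : ZS a10) (ha11 : ZS a11)
    (hb00 : ZS b00) (hb01 : ZS b01) (hb10 : ZS b10) (hb11 : ZS b11)
    (hc00 : ZS c00) (hc01 : ZS c01) (hc10 : ZS c10) (hc11 : ZS c11) :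
    Gd a00 b00 c00 + Gd a00 b01 c10 + Gd a01 b10 c00 + Gd a01 b11 c10
    + Gd a10 b00 c01 + Gd a10 b01 c11 + Gd a11 b10 c01 + Gd a11 b11 c11 =
    ∑ x ∈ PP S, (Ag a00 b00 c00 a00 b00 c00 a00 b00 c00 x.1 x.2.1 x.2.2
      + Ag a11 b11 c11 a11 b11 c11 a11 b11 c11 x.1 x.2.1 x.2.2)
    + ∑ x ∈ ND S, (Ag a00 b01 c10 a10 b00 c01 a01 (fun i j => - b10 i j) (fun i j => - c00 i j)
          x.1 x.2.1 x.2.2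
      + Ag a11 b10 c01 a01 b11 c10 a10 (fun i j => - b01 i j) (fun i j => - c11 i j)
          x.1 x.2.1 x.2.2)
    + ∑ x ∈ OD S, Wt (-S) (-S) (a00 x.1 x.2) (a01 x.1 x.2) (a10 x.1 x.2) (a11 x.1 x.2)
        (b00 x.1 x.2) (b01 x.1 x.2) (b10 x.1 x.2) (b11 x.1 x.2)
        (c00 x.1 x.2) (c01 x.1 x.2) (c10 x.1 x.2) (c11 x.1 x.2)
    + ∑ i, (Wt (9 - S) (-S) (a00 i i) (a01 i i) (a10 i i) (a11 i i)
        (b00 i i) (b01 i i) (b10 i i) (b11 i i) (c00 i i) (c01 i i) (c10 i i) (c11 i i)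
      + 1 * ((a00 i i + a10 i i + a01 i i) * (b01 i i + b00 i i - b10 i i)
          * (c10 i i + c01 i i - c00 i i))
      + (a11 i i + a01 i i + a10 i i) * (b10 i i + b11 i i - b01 i i)
          * (c01 i i + c10 i i - c11 i i)) := by
  have m0 := agg_all ha00 hb00 hc00 ha00 hb00 hc00 ha00 hb00 hc00
  have m1 := agg_all ha11 hb11 hc11 ha11 hb11 hc11 ha11 hb11 hc11
  have m2 := agg_all ha00 hb01 hc10 ha10 hb00 hc01 ha01 hb10.neg hc00.neg
  have m3 := agg_all ha11 hb10 hc01 ha01 hb11 hc10 ha10 hb01.neg hc11.neg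
  rw [sum_ND] at m0 m1 m2 m3
  rw [sum_PP _ (fun i j k => by unfold Ag; ring)] at m0 m1
  simp only [Gd_neg, Bd_neg2, Bd_neg3, Co_neg2, Co_neg3] at m2 m3
  have hco : ∑ i, ∑ j, Wt (-S) (-S) (a00 i j) (a01 i j) (a10 i j) (a11 i j)
      (b00 i j) (b01 i j) (b10 i j) (b11 i j) (c00 i j) (c01 i j) (c10 i j) (c11 i j) =
      -S * (Co a00 b00 c00 + Co a11 b11 c11 - Co a00 b10 c01 - Co a10 b01 c00 + Co a01 b00 c10
        - Co a11 b01 c10 - Co a01 b10 c11 + Co a10 b11 c01) := by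
    simp only [Co, ← Finset.sum_add_distrib, ← Finset.sum_sub_distrib, Finset.mul_sum]
    refine Finset.sum_congr rfl fun i _ => Finset.sum_congr rfl fun j _ => ?_
    unfold Wt; ring
  rw [sum_OD] at hco
  have hd : ∑ i, (Wt (9 - S) (-S) (a00 i i) (a01 i i) (a10 i i) (a11 i i)
        (b00 i i) (b01 i i) (b10 i i) (b11 i i) (c00 i i) (c01 i i) (c10 i i) (c11 i i)
      + 1 * ((a00 i i + a10 i i + a01 i i) * (b01 i i + b00 i i - b10 i i)
          * (c10 i i + c01 i i - c00 i i))
      + (a11 i i + a01 i i + a10 i i) * (b10 i i + b11 i i - b01 i i)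
          * (c01 i i + c10 i i - c11 i i)) =
      ∑ i, Wt (-S) (-S) (a00 i i) (a01 i i) (a10 i i) (a11 i i)
        (b00 i i) (b01 i i) (b10 i i) (b11 i i) (c00 i i) (c01 i i) (c10 i i) (c11 i i)
      + (1 / 3) * ∑ i, Ag a00 b00 c00 a00 b00 c00 a00 b00 c00 i i i
      + (1 / 3) * ∑ i, Ag a11 b11 c11 a11 b11 c11 a11 b11 c11 i i i
      + ∑ i, Ag a00 b01 c10 a10 b00 c01 a01 (fun i j => - b10 i j) (fun i j => - c00 i j) i i i
      + ∑ i, Ag a11 b10 c01 a01 b11 c10 a10 (fun i j => - b01 i j) (fun i j => - c11 i j) i i i := by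
    simp only [Finset.mul_sum, ← Finset.sum_add_distrib]
    refine Finset.sum_congr rfl fun i _ => ?_
    unfold Wt Ag; ring
  rw [hd]
  simp only [Finset.sum_add_distrib]
  linarith

end agg

section final

theorem Rk.main {V : Type} [AddCommGroup V] [Module ℚ V] {S : ℕ} (hS : S ≠ 0) (h9 : S ≠ 9)
    (e : Fin 2 → Fin 2 → Fin S → Fin S → V →ₗ[ℚ] ℚ)
    (he : ∀ α β A, ZS (fun i j => e α β i j A)) :
    Rk ((PP S).card * 2 + (ND S).card * 2 + (OD S).card * 7 + S * 8)
      (fun A B C => ∑ α, ∑ β, ∑ γ, Gd (fun i j => e α β i j A) (fun i j => e β γ i j B)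
        (fun i j => e γ α i j C)) := by
  have hS' : (-(S : ℚ)) ≠ 0 := by simpa using hS
  have h9' : (9 - (S : ℚ)) ≠ 0 := by
    intro h
    apply h9
    have : (S : ℚ) = 9 := by linarith
    exact_mod_cast this
  have hag : ∀ (A B C A' B' C' A'' B'' C'' : Fin S → Fin S → V →ₗ[ℚ] ℚ) (i j k : Fin S),
      Rk 1 (fun X Y Z => Ag (fun i j => A i j X) (fun i j => B i j Y) (fun i j => C i j Z)
        (fun i j => A' i j X) (fun i j => B' i j Y) (fun i j => C' i j Z)
        (fun i j => A'' i j X) (fun i j => B'' i j Y) (fun i j => C'' i j Z) i j k) := by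
    intro A B C A' B' C' A'' B'' C'' i j k
    exact (Rk.one (A i j + A' j k + A'' k i) (B j k + B' k i + B'' i j)
      (C k i + C' i j + C'' j k)).congr fun X Y Z => by simp [Ag]
  have r1 := Rk.sum (PP S) (t := 1 + 1) (fun x =>
    (hag (e 0 0) (e 0 0) (e 0 0) (e 0 0) (e 0 0) (e 0 0) (e 0 0) (e 0 0) (e 0 0) x.1 x.2.1 x.2.2).add
    (hag (e 1 1) (e 1 1) (e 1 1) (e 1 1) (e 1 1) (e 1 1) (e 1 1) (e 1 1) (e 1 1) x.1 x.2.1 x.2.2))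
  have r2 := Rk.sum (ND S) (t := 1 + 1) (fun x =>
    (hag (e 0 0) (e 0 1) (e 1 0) (e 1 0) (e 0 0) (e 0 1) (e 0 1) (fun i j => - e 1 0 i j)
      (fun i j => - e 0 0 i j) x.1 x.2.1 x.2.2).add
    (hag (e 1 1) (e 1 0) (e 0 1) (e 0 1) (e 1 1) (e 1 0) (e 1 0) (fun i j => - e 0 1 i j)
      (fun i j => - e 1 1 i j) x.1 x.2.1 x.2.2))
  have r3 := Rk.sum (OD S) (fun x => Rk.seven (-(S : ℚ)) (-(S : ℚ)) 0 hS' hS'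
    (e 0 0 x.1 x.2) (e 0 1 x.1 x.2) (e 1 0 x.1 x.2) (e 1 1 x.1 x.2)
    (e 0 0 x.1 x.2) (e 0 1 x.1 x.2) (e 1 0 x.1 x.2) (e 1 1 x.1 x.2)
    (e 0 0 x.1 x.2) (e 0 1 x.1 x.2) (e 1 0 x.1 x.2) (e 1 1 x.1 x.2))
  have r4 := Rk.sum (Finset.univ : Finset (Fin S)) (t := 7 + 1) (fun i =>
    (Rk.seven (9 - (S : ℚ)) (-(S : ℚ)) 1 h9' hS'
    (e 0 0 i i) (e 0 1 i i) (e 1 0 i i) (e 1 1 i i)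
    (e 0 0 i i) (e 0 1 i i) (e 1 0 i i) (e 1 1 i i)
    (e 0 0 i i) (e 0 1 i i) (e 1 0 i i) (e 1 1 i i)).add
    (Rk.one (e 1 1 i i + e 0 1 i i + e 1 0 i i) (e 1 0 i i + e 1 1 i i - e 0 1 i i)
      (e 0 1 i i + e 1 0 i i - e 1 1 i i)))
  rw [Finset.card_univ, Fintype.card_fin] at r4
  refine (((r1.add r2).add r3).add r4).congr fun A B C => ?_
  have := main_id (he 0 0 A) (he 0 1 A) (he 1 0 A) (he 1 1 A) (he 0 0 B) (he 0 1 B) (he 1 0 B)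
    (he 1 1 B) (he 0 0 C) (he 0 1 C) (he 1 0 C) (he 1 1 C)
  simp only [Fin.sum_univ_two, zero_mul, add_zero, LinearMap.add_apply, LinearMap.sub_apply,
    LinearMap.neg_apply]
  rw [← this]
  ring

/-- bordering matrix -/
def EE (s : ℕ) : Matrix (Fin (s + 1)) (Fin s) ℚ :=
  fun i k => (if i = k.castSucc then 1 else 0) - (if i = Fin.last s then 1 else 0)

/-- left inverse of the bordering matrix with zero row sums -/
def FF (s : ℕ) : Matrix (Fin s) (Fin (s + 1)) ℚ :=
  fun l j => (if j = l.castSucc then 1 else 0) - 1 / (s + 1)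

theorem FE (s : ℕ) : FF s * EE s = 1 := by
  ext l k
  have h : (Fin.last s) ≠ l.castSucc := (Fin.castSucc_lt_last l).ne'
  have : ∀ x : Fin (s + 1), FF s l x * EE s x k = (if x = k.castSucc then FF s l x else 0)
     - (if x = Fin.last s then FF s l x else 0) := by
    intro x; unfold EE; split_ifs <;> ring
  rw [Matrix.mul_apply]
  simp only [this, Finset.sum_sub_distrib, Finset.sum_ite_eq', Finset.mem_univ, if_true]
  simp only [FF, h, if_false, Matrix.one_apply, Fin.castSucc_inj, eq_comm (a := k)]
  ring

theorem sumE (s : ℕ) (k : Fin s) : ∑ i, EE s i k = 0 := by simp [EE]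

theorem sumF (s : ℕ) (l : Fin s) : ∑ j, FF s l j = 0 := by
  have : (s : ℚ) + 1 ≠ 0 := by positivity
  simp [FF, this]

/-- block of a `2s × 2s` matrix -/
def blk {s : ℕ} (α β : Fin 2) (A : Matrix (Fin (2 * s)) (Fin (2 * s)) ℚ) :
    Matrix (Fin s) (Fin s) ℚ :=
  fun i j => A (finProdFinEquiv (α, i)) (finProdFinEquiv (β, j))

/-- entries of bordered blocks -/
def ent {s : ℕ} (α β : Fin 2) (i j : Fin (s + 1)) :
    Matrix (Fin (2 * s)) (Fin (2 * s)) ℚ →ₗ[ℚ] ℚ where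
  toFun A := (EE s * blk α β A * FF s) i j
  map_add' A B := by
    have : blk α β (A + B) = blk α β A + blk α β B := rfl
    simp [this, Matrix.mul_add, Matrix.add_mul]
  map_smul' c A := by
    have : blk α β (c • A) = c • blk α β A := rfl
    simp [this]

theorem ent_ZS {s : ℕ} (α β : Fin 2) (A : Matrix (Fin (2 * s)) (Fin (2 * s)) ℚ) :
    ZS (fun i j => ent α β i j A) := by
  constructor
  · intro j
    show ∑ i, (EE s * blk α β A * FF s) i j = 0
    simp only [Matrix.mul_assoc, Matrix.mul_apply (M := EE s)]
    rw [Finset.sum_comm]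
    simp [← Finset.sum_mul, sumE]
  · intro i
    show ∑ j, (EE s * blk α β A * FF s) i j = 0
    simp only [Matrix.mul_apply (N := FF s)]
    rw [Finset.sum_comm]
    simp [← Finset.mul_sum, sumF]

theorem trace3 {n : Type} [Fintype n] (A B C : Matrix n n ℚ) :
    (A * B * C).trace = ∑ i, ∑ j, ∑ k, A i j * B j k * C k i := by
  simp only [Matrix.trace, Matrix.diag, Matrix.mul_apply, Finset.sum_mul]
  exact Finset.sum_congr rfl fun i _ => Finset.sum_comm

theorem Gd_ent {s : ℕ} (α β γ : Fin 2) (A B C : Matrix (Fin (2 * s)) (Fin (2 * s)) ℚ) :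
    Gd (fun i j => ent α β i j A) (fun i j => ent β γ i j B) (fun i j => ent γ α i j C) =
    (blk α β A * blk β γ B * blk γ α C).trace := by
  have h : Gd (fun i j => ent α β i j A) (fun i j => ent β γ i j B) (fun i j => ent γ α i j C) =
    ((EE s * blk α β A * FF s) * (EE s * blk β γ B * FF s) * (EE s * blk γ α C * FF s)).trace :=
    (trace3 _ _ _).symm
  rw [h]
  have : (EE s * blk α β A * FF s) * (EE s * blk β γ B * FF s) * (EE s * blk γ α C * FF s)
    = EE s * (blk α β A * (FF s * EE s) * blk β γ B * (FF s * EE s) * blk γ α C * FF s) := by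
    simp only [Matrix.mul_assoc]
  rw [this, Matrix.trace_mul_comm, Matrix.mul_assoc _ (FF s) (EE s), FE]
  simp

theorem sum_blk {s : ℕ} (f : Fin (2 * s) → ℚ) :
    ∑ x, f x = ∑ α : Fin 2, ∑ i : Fin s, f (finProdFinEquiv (α, i)) := by
  rw [← Fintype.sum_prod_type']
  exact (Equiv.sum_comp finProdFinEquiv f).symm

theorem trace_blk {s : ℕ} (A B C : Matrix (Fin (2 * s)) (Fin (2 * s)) ℚ) :
    (A * B * C).trace = ∑ α, ∑ β, ∑ γ, (blk α β A * blk β γ B * blk γ α C).trace := by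
  simp only [trace3, sum_blk, blk]
  refine Finset.sum_congr rfl fun α _ => ?_
  rw [Finset.sum_comm]
  refine Finset.sum_congr rfl fun β _ => ?_
  symm
  rw [Finset.sum_comm]
  refine Finset.sum_congr rfl fun i _ => ?_
  rw [Finset.sum_comm]

theorem Rk.alg {n t : ℕ}
    (h : Rk t (fun A B C : Matrix (Fin n) (Fin n) ℚ => (A * B * C).trace)) :
    ∃ (U V W : Matrix (Fin t) (Fin (n * n)) ℚ), IsMMAlg n n n t U V W := by
  obtain ⟨u, v, w, h⟩ := h
  have key : ∀ (l : Matrix (Fin n) (Fin n) ℚ →ₗ[ℚ] ℚ) (A : Matrix (Fin n) (Fin n) ℚ),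
      l A = ∑ x : Fin (n * n), l (Matrix.single x.divNat x.modNat 1) * A x.divNat x.modNat := by
    intro l A
    conv_lhs => rw [Matrix.matrix_eq_sum_single A]
    simp only [map_sum]
    rw [← Fintype.sum_prod_type' (f := fun i j => l (Matrix.single i j (A i j))),
      ← Equiv.sum_comp finProdFinEquiv.symm]
    refine Finset.sum_congr rfl fun x _ => ?_
    have : Matrix.single x.divNat x.modNat (A x.divNat x.modNat)
      = A x.divNat x.modNat • Matrix.single x.divNat x.modNat (1 : ℚ) := by simp
    simp only [finProdFinEquiv_symm_apply]
    rw [this, map_smul, smul_eq_mul, mul_comm]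
  refine ⟨fun r x => u r (Matrix.single x.divNat x.modNat 1),
    fun r x => v r (Matrix.single x.divNat x.modNat 1),
    fun r x => w r (Matrix.single x.divNat x.modNat 1), fun A B C => ?_⟩
  refine (h A B C).trans ?_
  refine Finset.sum_congr rfl fun r _ => ?_
  rw [key (u r), key (v r), key (w r)]
  rfl

end final

/-- The family `TA-New25`: for every even `n₀ ≥ 2`, `n₀ ≠ 16`, there is an
`⟨n₀,n₀,n₀;t⟩`-algorithm over `ℚ` with `12 * t = 4n₀³ + 45n₀² + 122n₀ + 96`. -/
theorem ta_new25_exists (n₀ : ℕ) (h2 : 2 ≤ n₀) (heven : Even n₀) (h16 : n₀ ≠ 16)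
    (t : ℕ) (ht : 12 * t = 4 * n₀ ^ 3 + 45 * n₀ ^ 2 + 122 * n₀ + 96) :
    ∃ (U V W : Matrix (Fin t) (Fin (n₀ * n₀)) ℚ),
      IsMMAlg n₀ n₀ n₀ t U V W := by
  obtain ⟨s, hs⟩ := heven
  obtain rfl : n₀ = 2 * s := by omega
  apply Rk.alg
  have h := Rk.main (S := s + 1) (by omega) (by omega) (ent (s := s)) ent_ZS
  have hc : (PP (s + 1)).card * 2 + (ND (s + 1)).card * 2 + (OD (s + 1)).card * 7 + (s + 1) * 8
      = t := by
    have h1 := card_ND (S := s + 1)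
    have h2 := card_PP (S := s + 1)
    have h3 := card_OD (S := s + 1)
    have h4 : (s + 1) ^ 3 = s ^ 3 + 3 * s ^ 2 + 3 * s + 1 := by ring
    have h5 : (s + 1) ^ 2 = s ^ 2 + 2 * s + 1 := by ring
    have h6 : 12 * t = 32 * s ^ 3 + 180 * s ^ 2 + 244 * s + 96 := by rw [ht]; ring
    omega
  rw [hc] at h
  refine h.congr fun A B C => ?_
  simp only [Gd_ent]
  exact trace_blk A B C
end

section
/- There exists a ⟨44,44,44;36110⟩-algorithm over ℚ; consequently the rank of the 44×44 matrix multiplication tensor is at most 36110. -/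
open Matrix

namespace MM

/-- The space of `44 × 44` rational matrices. -/
abbrev V : Type := Matrix (Fin 44) (Fin 44) ℚ

/-- A trilinear form is a sum of `t` products of linear functionals. -/
def HasRk (t : ℕ) (f : V → V → V → ℚ) : Prop :=
  ∃ u v w : Fin t → (V →ₗ[ℚ] ℚ), ∀ A B C, f A B C = ∑ r, u r A * v r B * w r C

theorem HasRk.congr {t : ℕ} {f g : V → V → V → ℚ} (h : HasRk t f)
    (e : ∀ A B C, g A B C = f A B C) : HasRk t g := by
  obtain ⟨u, v, w, hf⟩ := h
  exact ⟨u, v, w, fun A B C => by rw [e, hf]⟩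

theorem HasRk.one (u v w : V →ₗ[ℚ] ℚ) : HasRk 1 (fun A B C => u A * v B * w C) :=
  ⟨fun _ => u, fun _ => v, fun _ => w, fun A B C => by simp⟩

theorem HasRk.zero : HasRk 0 (fun _ _ _ => 0) :=
  ⟨fun _ => 0, fun _ => 0, fun _ => 0, fun A B C => by simp⟩

theorem HasRk.add {s t : ℕ} {f g : V → V → V → ℚ} (hf : HasRk s f) (hg : HasRk t g) :
    HasRk (s + t) (fun A B C => f A B C + g A B C) := by
  obtain ⟨u, v, w, hf⟩ := hf
  obtain ⟨u', v', w', hg⟩ := hg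
  refine ⟨Fin.append u u', Fin.append v v', Fin.append w w', fun A B C => ?_⟩
  simp only [Fin.sum_univ_add, hf, hg, Fin.append_left, Fin.append_right]

theorem HasRk.sum {ι : Type} (S : Finset ι) (k : ℕ) (f : ι → V → V → V → ℚ)
    (h : ∀ i, HasRk k (f i)) : HasRk (S.card * k) (fun A B C => ∑ i ∈ S, f i A B C) := by
  classical
  induction S using Finset.induction_on with
  | empty => simpa using HasRk.zero
  | insert a S ha ih =>
    have := (h a).add ih
    rw [Finset.card_insert_of_notMem ha, Nat.add_mul, one_mul, add_comm]
    exact this.congr fun A B C => by rw [Finset.sum_insert ha]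

/-- Passing from linear functionals to coefficient matrices. -/
theorem functional_eq (u : V →ₗ[ℚ] ℚ) (A : V) :
    u A = ∑ q : Fin (44 * 44), u (Matrix.single q.divNat q.modNat 1) * vec A q := by
  rw [← (finProdFinEquiv (m := 44) (n := 44)).sum_comp, Fintype.sum_prod_type]
  conv_lhs => rw [Matrix.matrix_eq_sum_single A]
  simp only [map_sum]
  refine Finset.sum_congr rfl fun i _ => Finset.sum_congr rfl fun j _ => ?_
  have h1 : (finProdFinEquiv (i, j) : Fin (44 * 44)).divNat = i :=
    congrArg Prod.fst (finProdFinEquiv.symm_apply_apply (i, j))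
  have h2 : (finProdFinEquiv (i, j) : Fin (44 * 44)).modNat = j :=
    congrArg Prod.snd (finProdFinEquiv.symm_apply_apply (i, j))
  have h3 : Matrix.single i j (A i j) = A i j • (Matrix.single i j (1 : ℚ) : V) := by
    rw [Matrix.smul_single, smul_eq_mul, mul_one]
  simp only [_root_.vec, h1, h2]
  rw [h3, map_smul, smul_eq_mul, mul_comm]

theorem HasRk.alg {t : ℕ} (h : HasRk t (fun A B C => (A * B * C).trace)) :
    ∃ (U V W : Matrix (Fin t) (Fin (44 * 44)) ℚ), IsMMAlg 44 44 44 t U V W := by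
  obtain ⟨u, v, w, h⟩ := h
  refine ⟨fun r q => u r (Matrix.single q.divNat q.modNat 1),
    fun r q => v r (Matrix.single q.divNat q.modNat 1),
    fun r q => w r (Matrix.single q.divNat q.modNat 1), fun A B C => ?_⟩
  refine (h A B C).trans ?_
  refine Finset.sum_congr rfl fun r _ => ?_
  rw [functional_eq (u r), functional_eq (v r), functional_eq (w r)]
  rfl

/-! ### Strassen's identity -/

/-- `trace (X * Y * Z)` for `2 × 2` matrices, entries listed row by row. -/
def tr2 (x0 x1 x2 x3 y0 y1 y2 y3 z0 z1 z2 z3 : ℚ) : ℚ :=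
  (x0 * y0 + x1 * y2) * z0 + (x0 * y1 + x1 * y3) * z2 +
  (x2 * y0 + x3 * y2) * z1 + (x2 * y1 + x3 * y3) * z3

/-- The form `κ * trace (X * Z * Y)` has rank at most 7 (Strassen). -/
theorem HasRk.strassen (κ : ℚ) (a0 a1 a2 a3 b0 b1 b2 b3 c0 c1 c2 c3 : V →ₗ[ℚ] ℚ) :
    HasRk 7 (fun A B C => κ * tr2 (a0 A) (a1 A) (a2 A) (a3 A)
      (c0 C) (c1 C) (c2 C) (c3 C) (b0 B) (b1 B) (b2 B) (b3 B)) := by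
  have h := (((((((HasRk.one (κ • (a0 + a3)) (b0 + b3) (c0 + c3)).add
    (HasRk.one (κ • (a2 + a3)) (b1 - b3) c0)).add
    (HasRk.one (κ • a0) (b2 + b3) (c1 - c3))).add
    (HasRk.one (κ • a3) (b0 + b1) (c2 - c0))).add
    (HasRk.one (κ • (a0 + a1)) (b2 - b0) c3)).add
    (HasRk.one (κ • (a2 - a0)) b3 (c0 + c1))).add
    (HasRk.one (κ • (a1 - a3)) b0 (c2 + c3)))
  refine h.congr fun A B C => ?_
  simp only [tr2, LinearMap.smul_apply, LinearMap.add_apply, LinearMap.sub_apply, smul_eq_mul]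
  ring

/-- The contribution of one diagonal position. -/
def diagForm (a0 a1 a2 a3 b0 b1 b2 b3 c0 c1 c2 c3 : ℚ) : ℚ :=
  9 * (a0 * b0 * c0) + 9 * (a3 * b3 * c3)
    + (-a0 - a1 + a2) * (-b0 - b1 + b2) * (-c0 - c1 + c2)
    + (a1 - a2 - a3) * (b1 - b2 - b3) * (c1 - c2 - c3)
    - 23 * tr2 a0 a1 a2 a3 c0 c1 c2 c3 b0 b1 b2 b3

/-- The diagonal form is, after a change of basis, a multiple of a `2 × 2` trace form plus a single
product of traces, so that its rank is at most 8. -/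
theorem HasRk.diag (a0 a1 a2 a3 b0 b1 b2 b3 c0 c1 c2 c3 : V →ₗ[ℚ] ℚ) :
    HasRk 8 (fun A B C => diagForm (a0 A) (a1 A) (a2 A) (a3 A)
      (b0 B) (b1 B) (b2 B) (b3 B) (c0 C) (c1 C) (c2 C) (c3 C)) := by
  let e0 : (V →ₗ[ℚ] ℚ) → (V →ₗ[ℚ] ℚ) → (V →ₗ[ℚ] ℚ) → (V →ₗ[ℚ] ℚ) → (V →ₗ[ℚ] ℚ) :=
    fun x0 x1 x2 x3 => (1 / 2 : ℚ) • (x0 + x3) + (23 / 34 : ℚ) • (x1 + x2)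
  let e1 : (V →ₗ[ℚ] ℚ) → (V →ₗ[ℚ] ℚ) → (V →ₗ[ℚ] ℚ) → (V →ₗ[ℚ] ℚ) → (V →ₗ[ℚ] ℚ) :=
    fun x0 x1 x2 x3 => (-23 / 34 : ℚ) • ((x2 - x1) + (x0 - x3))
  let e2 : (V →ₗ[ℚ] ℚ) → (V →ₗ[ℚ] ℚ) → (V →ₗ[ℚ] ℚ) → (V →ₗ[ℚ] ℚ) → (V →ₗ[ℚ] ℚ) :=
    fun x0 x1 x2 x3 => (19 / 34 : ℚ) • (x2 - x1) - (15 / 34 : ℚ) • (x0 - x3)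
  let e3 : (V →ₗ[ℚ] ℚ) → (V →ₗ[ℚ] ℚ) → (V →ₗ[ℚ] ℚ) → (V →ₗ[ℚ] ℚ) → (V →ₗ[ℚ] ℚ) :=
    fun x0 x1 x2 x3 => (1 / 2 : ℚ) • (x0 + x3) - (23 / 34 : ℚ) • (x1 + x2)
  have h := (HasRk.strassen (-289 / 23)
    (e0 a0 a1 a2 a3) (e1 a0 a1 a2 a3) (e2 a0 a1 a2 a3) (e3 a0 a1 a2 a3)
    (e0 b0 b1 b2 b3) (e1 b0 b1 b2 b3) (e2 b0 b1 b2 b3) (e3 b0 b1 b2 b3)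
    (e0 c0 c1 c2 c3) (e1 c0 c1 c2 c3) (e2 c0 c1 c2 c3) (e3 c0 c1 c2 c3)).add
    (HasRk.one ((-14 / 23 : ℚ) • (a0 + a3)) (b0 + b3) (c0 + c3))
  refine h.congr fun A B C => ?_
  simp only [e0, e1, e2, e3, tr2, diagForm, LinearMap.smul_apply, LinearMap.add_apply,
    LinearMap.sub_apply, smul_eq_mul]
  ring

/-! ### Summation lemmas -/

theorem sum_split {ι κ : Type} [Fintype ι] [Fintype κ] [DecidableEq κ] (g : ι ↪ κ) (f : κ → ℚ) :
    ∑ p, f p = ∑ p ∈ (Finset.univ.map g)ᶜ, f p + ∑ i, f (g i) := by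
  rw [← Finset.sum_compl_add_sum (Finset.univ.map g) f, Finset.sum_map]

/-- Triples of indices. -/
abbrev T3 : Type := Fin 23 × Fin 23 × Fin 23

/-- Cyclic rotation of triples. -/
def rot : T3 ≃ T3 where
  toFun p := (p.2.1, p.2.2, p.1)
  invFun p := (p.2.2, p.1, p.2.1)
  left_inv _ := rfl
  right_inv _ := rfl

/-- The diagonal embeddings. -/
def dg3 : Fin 23 ↪ T3 := ⟨fun i => (i, i, i), fun _ _ h => congrArg Prod.fst h⟩

def dg2 : Fin 23 ↪ Fin 23 × Fin 23 := ⟨fun i => (i, i), fun _ _ h => congrArg Prod.fst h⟩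

/-- Non-constant triples. -/
def N3 : Finset T3 := (Finset.univ.map dg3)ᶜ

/-- Off-diagonal pairs. -/
def N2 : Finset (Fin 23 × Fin 23) := (Finset.univ.map dg2)ᶜ

/-- Representatives of the cyclic classes of non-constant triples. -/
def S3 : Finset T3 := Finset.univ.filter fun p => p.1 ≤ p.2.1 ∧ p.1 < p.2.2

theorem card_N3 : N3.card = 12144 := by
  simp [N3, Finset.card_compl]

theorem card_N2 : N2.card = 506 := by
  simp [N2, Finset.card_compl]

theorem sum_cyc (f : T3 → ℚ) (hf : ∀ p, f (rot p) = f p) :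
    ∑ p, f p = 3 * ∑ p ∈ S3, f p + ∑ i, f (i, i, i) := by
  classical
  let χ : T3 → ℚ := fun p => if p.1 ≤ p.2.1 ∧ p.1 < p.2.2 then 1 else 0
  let δ : T3 → ℚ := fun p => if p.1 = p.2.1 ∧ p.2.1 = p.2.2 then 1 else 0
  have h1 : ∑ p ∈ S3, f p = ∑ p, χ p * f p := by
    simp [S3, χ, Finset.sum_filter]
  have h2 : ∑ p, χ (rot p) * f p = ∑ p, χ p * f p := by
    rw [← rot.sum_comp (fun p => χ p * f p)]
    simp [hf]
  have h3 : ∑ p, χ (rot (rot p)) * f p = ∑ p, χ p * f p := by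
    rw [← h2, ← rot.sum_comp (fun p => χ (rot p) * f p)]
    simp [hf]
  have h4 : ∑ p, δ p * f p = ∑ i, f (i, i, i) := by
    rw [sum_split dg3, Finset.sum_eq_zero, zero_add]
    · refine Finset.sum_congr rfl fun i _ => ?_
      have : dg3 i = (i, i, i) := rfl
      simp [δ, this]
    · rintro ⟨i, j, k⟩ hp
      have : ¬ (i = j ∧ j = k) := by
        rintro ⟨rfl, rfl⟩
        exact Finset.mem_compl.1 hp (Finset.mem_map.2 ⟨i, Finset.mem_univ i, rfl⟩)
      simp [δ, this]
  have h5 : ∀ p, f p = χ p * f p + χ (rot p) * f p + χ (rot (rot p)) * f p + δ p * f p := by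
    rintro ⟨i, j, k⟩
    have : χ (i, j, k) + χ (rot (i, j, k)) + χ (rot (rot (i, j, k))) + δ (i, j, k) = 1 := by
      simp only [χ, δ, rot, Equiv.coe_fn_mk, Fin.ext_iff, Fin.le_def, Fin.lt_def]
      split_ifs <;> first | omega | norm_num
    rw [← add_mul, ← add_mul, ← add_mul, this, one_mul]
  rw [Finset.sum_congr rfl fun p _ => h5 p]
  simp only [Finset.sum_add_distrib]
  rw [h1, h2, h3, h4]
  ring

theorem card_S3 : S3.card = 4048 := by
  have h := sum_cyc (fun _ => 1) (fun _ => rfl)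
  simp at h
  have : (S3.card : ℚ) = 4048 := by linarith
  exact_mod_cast this

/-! ### Trilinear aggregation -/

/-- Square matrices of size 23. -/
abbrev M : Type := Matrix (Fin 23) (Fin 23) ℚ

/-- All row sums and all column sums vanish. -/
def ZS (x : M) : Prop := (∀ i, ∑ j, x i j = 0) ∧ (∀ j, ∑ i, x i j = 0)

theorem ZS.neg {x : M} (h : ZS x) : ZS (-x) := by
  refine ⟨fun i => ?_, fun j => ?_⟩
  · simp [h.1 i]
  · simp [h.2 j]

/-- The main trilinear form. -/
def sD (x y z : M) : ℚ := ∑ i, ∑ j, ∑ k, x i j * y j k * z k i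

/-- The form with the wrong orientation. -/
def sW (x y z : M) : ℚ := ∑ i, ∑ j, ∑ k, x i j * y k i * z j k

/-- The entrywise form. -/
def sE (x y z : M) : ℚ := ∑ i, ∑ j, x i j * y i j * z i j

theorem rot_sum (f : Fin 23 → Fin 23 → Fin 23 → ℚ) :
    ∑ i, ∑ j, ∑ k, f j k i = ∑ i, ∑ j, ∑ k, f i j k := by
  rw [Finset.sum_comm]
  exact Finset.sum_congr rfl fun i _ => Finset.sum_comm

theorem rot_sum2 (f : Fin 23 → Fin 23 → Fin 23 → ℚ) :
    ∑ i, ∑ j, ∑ k, f k i j = ∑ i, ∑ j, ∑ k, f i j k := by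
  rw [← rot_sum (fun i j k => f k i j)]

theorem van1 (f : Fin 23 → Fin 23 → ℚ) {x : M} (h : ZS x) :
    ∑ i, ∑ j, ∑ k, f i j * x j k = 0 := by
  simp [← Finset.mul_sum, h.1]

theorem van2 (f : Fin 23 → Fin 23 → ℚ) {x : M} (h : ZS x) :
    ∑ i, ∑ j, ∑ k, f i j * x k i = 0 := by
  simp [← Finset.mul_sum, h.2]

theorem van3 (f : Fin 23 → Fin 23 → ℚ) {x : M} (h : ZS x) :
    ∑ i, ∑ j, ∑ k, f j k * x k i = 0 := by
  rw [rot_sum (fun i j k => f i j * x j k), van1 f h]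

theorem van4 (f : Fin 23 → Fin 23 → ℚ) {x : M} (h : ZS x) :
    ∑ i, ∑ j, ∑ k, f j k * x i j = 0 := by
  rw [rot_sum (fun i j k => f i j * x k i), van2 f h]

theorem van5 (f : Fin 23 → Fin 23 → ℚ) {x : M} (h : ZS x) :
    ∑ i, ∑ j, ∑ k, f k i * x i j = 0 := by
  rw [rot_sum2 (fun i j k => f i j * x j k), van1 f h]

theorem van6 (f : Fin 23 → Fin 23 → ℚ) {x : M} (h : ZS x) :
    ∑ i, ∑ j, ∑ k, f k i * x j k = 0 := by
  rw [rot_sum2 (fun i j k => f i j * x k i), van2 f h]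

/-- One term of the aggregate. -/
def agg (a1 a2 a3 b1 b2 b3 c1 c2 c3 : M) (i j k : Fin 23) : ℚ :=
  (a1 i j + a2 j k + a3 k i) * (b1 j k + b2 k i + b3 i j) * (c1 k i + c2 i j + c3 j k)

theorem agg_sum {a1 a2 a3 b1 b2 b3 c1 c2 c3 : M} (ha1 : ZS a1) (ha2 : ZS a2) (ha3 : ZS a3)
    (hb1 : ZS b1) (hb2 : ZS b2) (hb3 : ZS b3) (hc1 : ZS c1) (hc2 : ZS c2) (hc3 : ZS c3) :
    ∑ i, ∑ j, ∑ k, agg a1 a2 a3 b1 b2 b3 c1 c2 c3 i j k =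
      sD a1 b1 c1 + sD a2 b2 c2 + sD a3 b3 c3
      + (sW a1 b2 c3 + sW a2 b3 c1 + sW a3 b1 c2)
      + 23 * (sE a1 b3 c2 + sE a2 b1 c3 + sE a3 b2 c1) := by
  have key : ∀ i j k, agg a1 a2 a3 b1 b2 b3 c1 c2 c3 i j k =
      a1 i j * b1 j k * c1 k i + a2 j k * b2 k i * c2 i j + a3 k i * b3 i j * c3 j k
      + a1 i j * b2 k i * c3 j k + a2 j k * b3 i j * c1 k i + a3 k i * b1 j k * c2 i j
      + a1 i j * b3 i j * c2 i j + a2 j k * b1 j k * c3 j k + a3 k i * b2 k i * c1 k i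
      + (a1 i j * b3 i j) * c3 j k + (a1 i j * c2 i j) * b1 j k + (b3 i j * c2 i j) * a2 j k
      + (a1 i j * b3 i j) * c1 k i + (a1 i j * c2 i j) * b2 k i + (b3 i j * c2 i j) * a3 k i
      + (a2 j k * b1 j k) * c1 k i + (a2 j k * c3 j k) * b2 k i + (b1 j k * c3 j k) * a3 k i
      + (a2 j k * b1 j k) * c2 i j + (a2 j k * c3 j k) * b3 i j + (b1 j k * c3 j k) * a1 i j
      + (a3 k i * b2 k i) * c2 i j + (a3 k i * c1 k i) * b3 i j + (b2 k i * c1 k i) * a1 i j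
      + (a3 k i * b2 k i) * c3 j k + (a3 k i * c1 k i) * b1 j k + (b2 k i * c1 k i) * a2 j k := by
    intro i j k
    simp only [agg]
    ring
  simp only [key, Finset.sum_add_distrib]
  rw [van1 (fun i j => a1 i j * b3 i j) hc3, van1 (fun i j => a1 i j * c2 i j) hb1,
    van1 (fun i j => b3 i j * c2 i j) ha2,
    van2 (fun i j => a1 i j * b3 i j) hc1, van2 (fun i j => a1 i j * c2 i j) hb2,
    van2 (fun i j => b3 i j * c2 i j) ha3,
    van3 (fun i j => a2 i j * b1 i j) hc1, van3 (fun i j => a2 i j * c3 i j) hb2,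
    van3 (fun i j => b1 i j * c3 i j) ha3,
    van4 (fun i j => a2 i j * b1 i j) hc2, van4 (fun i j => a2 i j * c3 i j) hb3,
    van4 (fun i j => b1 i j * c3 i j) ha1,
    van5 (fun i j => a3 i j * b2 i j) hc2, van5 (fun i j => a3 i j * c1 i j) hb3,
    van5 (fun i j => b2 i j * c1 i j) ha1,
    van6 (fun i j => a3 i j * b2 i j) hc3, van6 (fun i j => a3 i j * c1 i j) hb1,
    van6 (fun i j => b2 i j * c1 i j) ha2]
  rw [rot_sum (fun i j k => a2 i j * b2 j k * c2 k i),
    rot_sum2 (fun i j k => a3 i j * b3 j k * c3 k i),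
    rot_sum (fun i j k => a2 i j * b3 k i * c1 j k),
    rot_sum2 (fun i j k => a3 i j * b1 k i * c2 j k),
    rot_sum (fun i j _ => a2 i j * b1 i j * c3 i j),
    rot_sum2 (fun i j _ => a3 i j * b2 i j * c1 i j)]
  simp only [sD, sW, sE, Finset.sum_const, Finset.card_univ, Fintype.card_fin, nsmul_eq_mul,
    ← Finset.mul_sum]
  push_cast
  ring

theorem sum_T3 (f : Fin 23 → Fin 23 → Fin 23 → ℚ) :
    ∑ i, ∑ j, ∑ k, f i j k = ∑ p : T3, f p.1 p.2.1 p.2.2 := by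
  simp only [Fintype.sum_prod_type]

theorem sum_N3 (f : Fin 23 → Fin 23 → Fin 23 → ℚ) :
    ∑ i, ∑ j, ∑ k, f i j k = ∑ p ∈ N3, f p.1 p.2.1 p.2.2 + ∑ i, f i i i := by
  rw [sum_T3, sum_split dg3]
  rfl

theorem sum_N2 (f : Fin 23 → Fin 23 → ℚ) :
    ∑ i, ∑ j, f i j = ∑ p ∈ N2, f p.1 p.2 + ∑ i, f i i := by
  rw [← Fintype.sum_prod_type', sum_split dg2]
  rfl

theorem agg_sum_sym {a b c : M} (ha : ZS a) (hb : ZS b) (hc : ZS c) :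
    ∑ p ∈ S3, agg a a a b b b c c c p.1 p.2.1 p.2.2 + 9 * ∑ i, a i i * b i i * c i i =
      sD a b c + sW a b c + 23 * sE a b c := by
  have h1 := agg_sum ha ha ha hb hb hb hc hc hc
  rw [sum_T3, sum_cyc] at h1
  · have h2 : ∑ i, agg a a a b b b c c c i i i = 27 * ∑ i, a i i * b i i * c i i := by
      rw [Finset.mul_sum]
      refine Finset.sum_congr rfl fun i _ => ?_
      simp only [agg]
      ring
    simp only [h2] at h1
    linarith
  · rintro ⟨i, j, k⟩
    simp only [agg, rot, Equiv.coe_fn_mk]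
    ring

/-- The complete identity for zero-sum blocks. -/
theorem main_identity (a b c : Fin 2 → Fin 2 → M) (ha : ∀ α β, ZS (a α β))
    (hb : ∀ α β, ZS (b α β)) (hc : ∀ α β, ZS (c α β)) :
    ∑ α, ∑ β, ∑ γ, sD (a α β) (b β γ) (c γ α) =
      ∑ p ∈ S3, agg (a 0 0) (a 0 0) (a 0 0) (b 0 0) (b 0 0) (b 0 0) (c 0 0) (c 0 0) (c 0 0)
        p.1 p.2.1 p.2.2
      + ∑ p ∈ S3, agg (a 1 1) (a 1 1) (a 1 1) (b 1 1) (b 1 1) (b 1 1) (c 1 1) (c 1 1) (c 1 1)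
        p.1 p.2.1 p.2.2
      + ∑ p ∈ N3, agg (-a 0 0) (a 1 0) (-a 0 1) (-b 0 1) (-b 0 0) (b 1 0)
        (c 1 0) (-c 0 1) (-c 0 0) p.1 p.2.1 p.2.2
      + ∑ p ∈ N3, agg (-a 1 1) (a 0 1) (-a 1 0) (-b 1 0) (-b 1 1) (b 0 1)
        (c 0 1) (-c 1 0) (-c 1 1) p.1 p.2.1 p.2.2
      + ∑ p ∈ N2, (-23) * tr2
        (a 0 0 p.1 p.2) (a 0 1 p.1 p.2) (a 1 0 p.1 p.2) (a 1 1 p.1 p.2)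
        (c 0 0 p.1 p.2) (c 0 1 p.1 p.2) (c 1 0 p.1 p.2) (c 1 1 p.1 p.2)
        (b 0 0 p.1 p.2) (b 0 1 p.1 p.2) (b 1 0 p.1 p.2) (b 1 1 p.1 p.2)
      + ∑ i, diagForm (a 0 0 i i) (a 0 1 i i) (a 1 0 i i) (a 1 1 i i)
        (b 0 0 i i) (b 0 1 i i) (b 1 0 i i) (b 1 1 i i)
        (c 0 0 i i) (c 0 1 i i) (c 1 0 i i) (c 1 1 i i) := by
  have g1 := agg_sum_sym (ha 0 0) (hb 0 0) (hc 0 0)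
  have g2 := agg_sum_sym (ha 1 1) (hb 1 1) (hc 1 1)
  have g3 := agg_sum (ha 0 0).neg (ha 1 0) (ha 0 1).neg (hb 0 1).neg (hb 0 0).neg (hb 1 0)
    (hc 1 0) (hc 0 1).neg (hc 0 0).neg
  have g4 := agg_sum (ha 1 1).neg (ha 0 1) (ha 1 0).neg (hb 1 0).neg (hb 1 1).neg (hb 0 1)
    (hc 0 1) (hc 1 0).neg (hc 1 1).neg
  rw [sum_N3] at g3 g4
  have g5 := sum_N2 (fun i j => (-23) * tr2
        (a 0 0 i j) (a 0 1 i j) (a 1 0 i j) (a 1 1 i j)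
        (c 0 0 i j) (c 0 1 i j) (c 1 0 i j) (c 1 1 i j)
        (b 0 0 i j) (b 0 1 i j) (b 1 0 i j) (b 1 1 i j))
  have g6 : ∑ i, ∑ j, (-23) * tr2
        (a 0 0 i j) (a 0 1 i j) (a 1 0 i j) (a 1 1 i j)
        (c 0 0 i j) (c 0 1 i j) (c 1 0 i j) (c 1 1 i j)
        (b 0 0 i j) (b 0 1 i j) (b 1 0 i j) (b 1 1 i j) =
      (-23) * (sE (a 0 0) (b 0 0) (c 0 0) + sE (a 0 1) (b 0 0) (c 1 0)
        + sE (a 0 0) (b 1 0) (c 0 1) + sE (a 0 1) (b 1 0) (c 1 1)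
        + sE (a 1 0) (b 0 1) (c 0 0) + sE (a 1 1) (b 0 1) (c 1 0)
        + sE (a 1 0) (b 1 1) (c 0 1) + sE (a 1 1) (b 1 1) (c 1 1)) := by
    simp only [sE, ← Finset.sum_add_distrib, Finset.mul_sum]
    refine Finset.sum_congr rfl fun i _ => Finset.sum_congr rfl fun j _ => ?_
    simp only [tr2]
    ring
  have g7 : ∑ i, diagForm (a 0 0 i i) (a 0 1 i i) (a 1 0 i i) (a 1 1 i i)
        (b 0 0 i i) (b 0 1 i i) (b 1 0 i i) (b 1 1 i i)
        (c 0 0 i i) (c 0 1 i i) (c 1 0 i i) (c 1 1 i i) =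
      9 * ∑ i, a 0 0 i i * b 0 0 i i * c 0 0 i i + 9 * ∑ i, a 1 1 i i * b 1 1 i i * c 1 1 i i
      + ∑ i, agg (-a 0 0) (a 1 0) (-a 0 1) (-b 0 1) (-b 0 0) (b 1 0)
        (c 1 0) (-c 0 1) (-c 0 0) i i i
      + ∑ i, agg (-a 1 1) (a 0 1) (-a 1 0) (-b 1 0) (-b 1 1) (b 0 1)
        (c 0 1) (-c 1 0) (-c 1 1) i i i
      + ∑ i, (-23) * tr2
        (a 0 0 i i) (a 0 1 i i) (a 1 0 i i) (a 1 1 i i)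
        (c 0 0 i i) (c 0 1 i i) (c 1 0 i i) (c 1 1 i i)
        (b 0 0 i i) (b 0 1 i i) (b 1 0 i i) (b 1 1 i i) := by
    simp only [← Finset.sum_add_distrib, Finset.mul_sum]
    refine Finset.sum_congr rfl fun i _ => ?_
    simp only [diagForm, agg, Matrix.neg_apply]
    ring
  rw [g6] at g5
  have negs : (∀ x y z, sD (-x) y z = - sD x y z) ∧ (∀ x y z, sD x (-y) z = - sD x y z) ∧
      (∀ x y z, sD x y (-z) = - sD x y z) := by
    refine ⟨?_, ?_, ?_⟩ <;> intro x y z <;> simp [sD]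
  have negs' : (∀ x y z, sW (-x) y z = - sW x y z) ∧ (∀ x y z, sW x (-y) z = - sW x y z) ∧
      (∀ x y z, sW x y (-z) = - sW x y z) := by
    refine ⟨?_, ?_, ?_⟩ <;> intro x y z <;> simp [sW]
  have negs'' : (∀ x y z, sE (-x) y z = - sE x y z) ∧ (∀ x y z, sE x (-y) z = - sE x y z) ∧
      (∀ x y z, sE x y (-z) = - sE x y z) := by
    refine ⟨?_, ?_, ?_⟩ <;> intro x y z <;> simp [sE]
  simp only [negs.1, negs.2.1, negs.2.2, negs'.1, negs'.2.1, negs'.2.2, negs''.1, negs''.2.1,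
    negs''.2.2, neg_neg] at g3 g4
  rw [g7]
  simp only [Fin.sum_univ_two]
  linarith

/-! ### Embedding of the blocks into zero-sum matrices -/

/-- The matrix `[I | -1]`. -/
def pM : Matrix (Fin 22) (Fin 23) ℚ :=
  fun i j => (if j = i.castSucc then 1 else 0) - (if j = Fin.last 22 then 1 else 0)

/-- A right inverse of `pM` with vanishing column sums. -/
def qM : Matrix (Fin 23) (Fin 22) ℚ :=
  fun i j => (if i = j.castSucc then 1 else 0) - 1 / 23

theorem pM_mul_qM : pM * qM = 1 := by
  ext i j
  simp only [Matrix.mul_apply, pM, qM, sub_mul, Finset.sum_sub_distrib, ite_mul, one_mul, zero_mul,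
    Finset.sum_ite_eq', Finset.mem_univ, if_true, Matrix.one_apply]
  have : ¬ Fin.last 22 = j.castSucc := (Fin.castSucc_lt_last j).ne'
  rw [if_neg this]
  simp [Fin.ext_iff]

theorem pM_sum (i : Fin 22) : ∑ j, pM i j = 0 := by
  simp [pM]

theorem qM_sum (j : Fin 22) : ∑ i, qM i j = 0 := by
  simp [qM]

/-- The index of row `i` of block `α`. -/
def ix (α : Fin 2) (i : Fin 22) : Fin 44 := (finProdFinEquiv (α, i) : Fin (2 * 22))

/-- The plain `22 × 22` block. -/
def pb (A : V) (α β : Fin 2) : Matrix (Fin 22) (Fin 22) ℚ := A.submatrix (ix α) (ix β)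

/-- The zero-sum `23 × 23` block. -/
def bk (A : V) (α β : Fin 2) : M := qM * pb A α β * pM

theorem bk_zs (A : V) (α β : Fin 2) : ZS (bk A α β) := by
  refine ⟨fun i => ?_, fun j => ?_⟩
  · simp only [bk, Matrix.mul_apply (M := qM * pb A α β)]
    rw [Finset.sum_comm]
    simp [← Finset.mul_sum, pM_sum]
  · simp only [bk, Matrix.mul_assoc, Matrix.mul_apply (M := qM)]
    rw [Finset.sum_comm]
    simp [← Finset.sum_mul, qM_sum]

theorem sum_ix (f : Fin 44 → ℚ) : ∑ q, f q = ∑ α, ∑ i, f (ix α i) := by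
  rw [← Fintype.sum_prod_type']
  exact ((finProdFinEquiv (m := 2) (n := 22)).sum_comp f).symm

theorem sD_eq (x y z : M) : sD x y z = (x * y * z).trace := by
  simp only [sD, Matrix.trace, Matrix.diag, Matrix.mul_apply, Finset.sum_mul]
  exact Finset.sum_congr rfl fun i _ => Finset.sum_comm

theorem trace_blocks (A B C : V) :
    (A * B * C).trace = ∑ α, ∑ β, ∑ γ, sD (bk A α β) (bk B β γ) (bk C γ α) := by
  have h : ∀ α β γ, sD (bk A α β) (bk B β γ) (bk C γ α) =
      ∑ i, ∑ j, ∑ k, A (ix α i) (ix β j) * B (ix β j) (ix γ k) * C (ix γ k) (ix α i) := by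
    intro α β γ
    rw [sD_eq]
    have : bk A α β * bk B β γ * bk C γ α = qM * (pb A α β * pb B β γ * pb C γ α * pM) := by
      simp only [bk]
      calc qM * pb A α β * pM * (qM * pb B β γ * pM) * (qM * pb C γ α * pM)
          = qM * (pb A α β * (pM * qM) * pb B β γ * (pM * qM) * pb C γ α * pM) := by
            simp only [Matrix.mul_assoc]
        _ = _ := by simp only [pM_mul_qM, Matrix.mul_one]
    rw [this, Matrix.trace_mul_comm, Matrix.mul_assoc, pM_mul_qM, Matrix.mul_one]
    simp only [Matrix.trace, Matrix.diag, Matrix.mul_apply, Finset.sum_mul, pb,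
      Matrix.submatrix_apply]
    exact Finset.sum_congr rfl fun i _ => Finset.sum_comm
  simp only [h]
  simp only [Matrix.trace, Matrix.diag, Matrix.mul_apply, Finset.sum_mul]
  rw [sum_ix]
  refine Finset.sum_congr rfl fun α _ => ?_
  have : ∀ i : Fin 22, ∑ x, ∑ y, A (ix α i) y * B y x * C x (ix α i) =
      ∑ β, ∑ γ, ∑ j, ∑ k, A (ix α i) (ix β j) * B (ix β j) (ix γ k) * C (ix γ k) (ix α i) := by
    intro i
    rw [Finset.sum_comm, sum_ix]
    refine Finset.sum_congr rfl fun β _ => ?_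
    refine Eq.trans ?_ Finset.sum_comm
    refine Finset.sum_congr rfl fun j _ => ?_
    rw [sum_ix]
  simp only [this]
  rw [Finset.sum_comm]
  exact Finset.sum_congr rfl fun β _ => Finset.sum_comm

/-- The entries of the zero-sum blocks as linear functionals. -/
def en (α β : Fin 2) (i j : Fin 23) : V →ₗ[ℚ] ℚ where
  toFun A := bk A α β i j
  map_add' A B := by
    have : pb (A + B) α β = pb A α β + pb B α β := rfl
    simp [bk, this, Matrix.mul_add, Matrix.add_mul]
  map_smul' r A := by
    have : pb (r • A) α β = r • pb A α β := rfl
    simp [bk, this]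

theorem en_apply (α β : Fin 2) (i j : Fin 23) (A : V) : en α β i j A = bk A α β i j := rfl

theorem rk_trace : HasRk 36110 (fun A B C => (A * B * C).trace) := by
  have r1 : ∀ α : Fin 2, HasRk (S3.card * 1) (fun A B C => ∑ p ∈ S3,
      agg (bk A α α) (bk A α α) (bk A α α) (bk B α α) (bk B α α) (bk B α α)
        (bk C α α) (bk C α α) (bk C α α) p.1 p.2.1 p.2.2) := by
    intro α
    refine HasRk.sum S3 1 (fun p A B C => agg (bk A α α) (bk A α α) (bk A α α)
      (bk B α α) (bk B α α) (bk B α α) (bk C α α) (bk C α α) (bk C α α) p.1 p.2.1 p.2.2) ?_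
    rintro ⟨i, j, k⟩
    refine (HasRk.one (en α α i j + en α α j k + en α α k i)
      (en α α j k + en α α k i + en α α i j)
      (en α α k i + en α α i j + en α α j k)).congr fun A B C => ?_
    simp only [agg, LinearMap.add_apply, en_apply]
  have r2 : ∀ α β : Fin 2, HasRk (N3.card * 1) (fun A B C => ∑ p ∈ N3,
      agg (-bk A α α) (bk A β α) (-bk A α β) (-bk B α β) (-bk B α α) (bk B β α)
        (bk C β α) (-bk C α β) (-bk C α α) p.1 p.2.1 p.2.2) := by
    intro α β
    refine HasRk.sum N3 1 (fun p A B C => agg (-bk A α α) (bk A β α) (-bk A α β)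
      (-bk B α β) (-bk B α α) (bk B β α)
      (bk C β α) (-bk C α β) (-bk C α α) p.1 p.2.1 p.2.2) ?_
    rintro ⟨i, j, k⟩
    refine (HasRk.one (-en α α i j + en β α j k + -en α β k i)
      (-en α β j k + -en α α k i + en β α i j)
      (en β α k i + -en α β i j + -en α α j k)).congr fun A B C => ?_
    simp only [agg, LinearMap.add_apply, LinearMap.neg_apply, Matrix.neg_apply, en_apply]
  have r3 := HasRk.sum N2 7 (fun p A B C => (-23) * tr2
    (en 0 0 p.1 p.2 A) (en 0 1 p.1 p.2 A) (en 1 0 p.1 p.2 A) (en 1 1 p.1 p.2 A)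
    (en 0 0 p.1 p.2 C) (en 0 1 p.1 p.2 C) (en 1 0 p.1 p.2 C) (en 1 1 p.1 p.2 C)
    (en 0 0 p.1 p.2 B) (en 0 1 p.1 p.2 B) (en 1 0 p.1 p.2 B) (en 1 1 p.1 p.2 B))
    (fun p => HasRk.strassen _ _ _ _ _ _ _ _ _ _ _ _ _)
  have r4 := HasRk.sum (Finset.univ : Finset (Fin 23)) 8 (fun i A B C => diagForm
    (en 0 0 i i A) (en 0 1 i i A) (en 1 0 i i A) (en 1 1 i i A)
    (en 0 0 i i B) (en 0 1 i i B) (en 1 0 i i B) (en 1 1 i i B)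
    (en 0 0 i i C) (en 0 1 i i C) (en 1 0 i i C) (en 1 1 i i C))
    (fun i => HasRk.diag _ _ _ _ _ _ _ _ _ _ _ _)
  have h := (((((r1 0).add (r1 1)).add (r2 0 1)).add (r2 1 0)).add r3).add r4
  rw [card_S3, card_N3, card_N2, Finset.card_univ, Fintype.card_fin] at h
  refine HasRk.congr h fun A B C => ?_
  rw [trace_blocks, main_identity (bk A) (bk B) (bk C) (bk_zs A) (bk_zs B) (bk_zs C)]
  simp only [en_apply]

end MM

/-- There exists a `⟨44,44,44;36110⟩`-algorithm over `ℚ` (hence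
`rank ⟨44,44,44⟩ ≤ 36110`). -/
theorem exists_44_44_44_36110_algorithm :
    ∃ (U V W : Matrix (Fin 36110) (Fin (44 * 44)) ℚ),
      IsMMAlg 44 44 44 36110 U V W := by
  exact MM.rk_trace.alg
end

section
/- For every even natural number m₀ ≥ 2 with m₀ ≠ 16, setting n₀ = m₀², there exists an ⟨n₀,n₀,n₀;t⟩-algorithm over ℚ, where t = (4·m₀⁶ + 90·m₀⁵ + 748·m₀⁴ + 2928·m₀³ + 5872·m₀² + 5856·m₀ + 2304)/36; equivalently, t = t'² − h² where t' = (4·m₀³ + 45·m₀² + 122·m₀ + 96)/12 and h = m₀²/4 + m₀/2. -/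
open Matrix

namespace TA

/-- `T` is a sum of `r` rank-one trilinear forms. -/
def Rk {V : Type} [AddCommGroup V] [Module ℚ V] (T : V → V → V → ℚ) (r : ℕ) : Prop :=
  ∃ f g h : Fin r → (V →ₗ[ℚ] ℚ), ∀ a b c, T a b c = ∑ i, f i a * g i b * h i c

section rank
variable {V : Type} [AddCommGroup V] [Module ℚ V]

theorem Rk.congr {T T' : V → V → V → ℚ} {r : ℕ} (h : Rk T r) (e : ∀ a b c, T' a b c = T a b c) :
    Rk T' r := by
  obtain ⟨f, g, k, H⟩ := h
  exact ⟨f, g, k, fun a b c => by rw [e, H]⟩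

theorem Rk.zero : Rk (fun _ _ _ : V => (0 : ℚ)) 0 :=
  ⟨fun _ => 0, fun _ => 0, fun _ => 0, fun a b c => by simp⟩

theorem Rk.one (f g h : V →ₗ[ℚ] ℚ) : Rk (fun a b c => f a * g b * h c) 1 :=
  ⟨fun _ => f, fun _ => g, fun _ => h, fun a b c => by simp⟩

theorem Rk.add {T T' : V → V → V → ℚ} {r r' : ℕ} (h : Rk T r) (h' : Rk T' r') :
    Rk (fun a b c => T a b c + T' a b c) (r + r') := by
  obtain ⟨f, g, k, H⟩ := h
  obtain ⟨f', g', k', H'⟩ := h'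
  refine ⟨Fin.append f f', Fin.append g g', Fin.append k k', fun a b c => ?_⟩
  rw [Fin.sum_univ_add]
  simp [H, H']

theorem Rk.smul {T : V → V → V → ℚ} {r : ℕ} (q : ℚ) (h : Rk T r) :
    Rk (fun a b c => q * T a b c) r := by
  obtain ⟨f, g, k, H⟩ := h
  refine ⟨fun i => q • f i, g, k, fun a b c => ?_⟩
  beta_reduce
  rw [H, Finset.mul_sum]
  exact Finset.sum_congr rfl fun i _ => by simp; ring

theorem Rk.mono {T : V → V → V → ℚ} {r r' : ℕ} (h : Rk T r) (hr : r ≤ r') : Rk T r' := by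
  obtain ⟨d, rfl⟩ := Nat.exists_eq_add_of_le hr
  obtain ⟨f, g, k, H⟩ := h
  refine ⟨Fin.append f fun _ => 0, Fin.append g fun _ => 0, Fin.append k fun _ => 0,
    fun a b c => ?_⟩
  rw [Fin.sum_univ_add]
  simp [H]

theorem Rk.sum {ι : Type} (s : Finset ι) (T : ι → V → V → V → ℚ) (r : ι → ℕ)
    (h : ∀ i ∈ s, Rk (T i) (r i)) : Rk (fun a b c => ∑ i ∈ s, T i a b c) (∑ i ∈ s, r i) := by
  classical
  induction s using Finset.induction_on with
  | empty => simpa using Rk.zero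
  | insert x s hx ih =>
    rw [Finset.sum_insert hx]
    refine Rk.congr ((h x (by simp)).add (ih fun i hi => h i (by simp [hi]))) fun a b c => ?_
    rw [Finset.sum_insert hx]

end rank

/-- Sign of a bit. -/
def sg (x : Bool) : ℚ := if x then -1 else 1

@[simp] theorem sg_true : sg true = -1 := rfl
@[simp] theorem sg_false : sg false = 1 := rfl

/-- The twisted 2x2 product form. -/
def Mf (a b c : Bool → Bool → ℚ) : ℚ :=
  ∑ α, ∑ β, ∑ γ, a α β * b γ α * c β γ

/-- Sum of the eight diagonal aggregates, divided by three. -/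
def Af (a b c : Bool → Bool → ℚ) : ℚ :=
  9 * (a false false * b false false * c false false)
  + 9 * (a true true * b true true * c true true)
  - (a false false + a false true - a true false) * (b false false + b false true - b true false)
    * (c false false + c false true - c true false)
  - (a true true + a true false - a false true) * (b true true + b true false - b false true)
    * (c true true + c true false - c false true)

section forms
variable {V : Type} [AddCommGroup V] [Module ℚ V]

theorem rk_Mf (l : Bool → Bool → (V →ₗ[ℚ] ℚ)) :
    Rk (fun a b c => Mf (fun α β => l α β a) (fun α β => l α β b) (fun α β => l α β c)) 7 := by
  have e := ((((((Rk.one (l false false + l true true) (l false false + l true true)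
      (l false false + l true true)).add
    (Rk.one (l true false + l true true) (l false true - l true true) (l false false))).add
    (Rk.one (l false false) (l true false + l true true) (l false true - l true true))).add
    (Rk.one (l true true) (l false false + l false true) (l true false - l false false))).add
    (Rk.one (l false false + l false true) (l true false - l false false) (l true true))).add
    (Rk.one (l true false - l false false) (l true true) (l false false + l false true))).add
    (Rk.one (l false true - l true true) (l false false) (l true false + l true true))
  refine e.congr fun a b c => ?_
  simp only [Mf, Fintype.sum_bool, LinearMap.add_apply, LinearMap.sub_apply]
  ring

theorem rk_Af (l : Bool → Bool → (V →ₗ[ℚ] ℚ)) :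
    Rk (fun a b c => Af (fun α β => l α β a) (fun α β => l α β b) (fun α β => l α β c)) 4 := by
  have e := (((Rk.one (l false false) (l false false) (l false false)).smul 9).add
    ((Rk.one (l true true) (l true true) (l true true)).smul 9)).add
    (((Rk.one (l false false + l false true - l true false)
      (l false false + l false true - l true false)
      (l false false + l false true - l true false)).smul (-1)).add
    ((Rk.one (l true true + l true false - l false true)
      (l true true + l true false - l false true)
      (l true true + l true false - l false true)).smul (-1)))
  refine e.congr fun a b c => ?_
  simp only [Af, LinearMap.add_apply, LinearMap.sub_apply]
  ring

/-- The diagonal form has rank at most seven at the parameter `9`. -/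
theorem rk_diag (l : Bool → Bool → (V →ₗ[ℚ] ℚ)) :
    Rk (fun a b c => Af (fun α β => l α β a) (fun α β => l α β b) (fun α β => l α β c)
      - 9 * Mf (fun α β => l α β a) (fun α β => l α β b) (fun α β => l α β c)) 7 := by
  have cube : ∀ f : V →ₗ[ℚ] ℚ, Rk (fun a b c => f a * f b * f c) 1 := fun f => Rk.one f f f
  have e := (((cube (l false false - (2 : ℚ) • l false true + (2 : ℚ) • l true false)).add
    ((cube (l true true + l true false - l false true)).smul (-1))).add
    (((cube (l false false + l false true + (2 : ℚ) • l true false)).smul (-1)).add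
    ((cube (l false false - (2 : ℚ) • l false true - l true false)).smul (-1)))).add
    (((Rk.one (l true false)
        (l false false - l true true - l false true + l true false) (l false true)).smul 9).add
    (((Rk.one (l false true) (l true false)
        (l false false - l true true - l false true + l true false)).smul 9).add
    ((Rk.one (l false false - l true true - l false true + l true false) (l false true)
        (l true false)).smul 9)))
  refine e.congr fun a b c => ?_
  simp only [Af, Mf, Fintype.sum_bool, LinearMap.add_apply, LinearMap.sub_apply,
    LinearMap.smul_apply, smul_eq_mul]
  ring

end forms

set_option linter.unusedSectionVars false

section core
variable {I : Type} [Fintype I] (w : I → ℚ)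

/-- Weighted zero row and column sums. -/
def ZS (x : I → I → ℚ) : Prop :=
  (∀ j, ∑ i, w i * x i j = 0) ∧ (∀ i, ∑ j, w j * x i j = 0)

def Cf (x y z : I → I → ℚ) : ℚ := ∑ i, ∑ j, ∑ k, w i * w j * w k * (x i j * y j k * z k i)
def Bf (x y z : I → I → ℚ) : ℚ := ∑ i, ∑ j, ∑ k, w i * w j * w k * (x i j * y k i * z j k)
def Mo (x y z : I → I → ℚ) : ℚ := ∑ i, ∑ j, w i * w j * (x i j * y i j * z i j)

theorem rot (f : I → I → I → ℚ) : ∑ i, ∑ j, ∑ k, f i j k = ∑ i, ∑ j, ∑ k, f k i j := by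
  rw [Finset.sum_comm]
  refine Finset.sum_congr rfl fun j _ => ?_
  rw [Finset.sum_comm]

theorem kill1 (f : I → I → ℚ) (g : I → I → I → ℚ) (h : ∀ j k, ∑ i, w i * g i j k = 0) :
    ∑ i, ∑ j, ∑ k, w i * w j * w k * (g i j k * f j k) = 0 := by
  rw [Finset.sum_comm]
  refine Finset.sum_eq_zero fun j _ => ?_
  rw [Finset.sum_comm]
  refine Finset.sum_eq_zero fun k _ => ?_
  rw [← mul_zero (w j * w k * f j k), ← h j k, Finset.mul_sum]
  exact Finset.sum_congr rfl fun i _ => by ring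

theorem kill2 (f : I → I → ℚ) (g : I → I → I → ℚ) (h : ∀ i k, ∑ j, w j * g i j k = 0) :
    ∑ i, ∑ j, ∑ k, w i * w j * w k * (g i j k * f i k) = 0 := by
  refine Finset.sum_eq_zero fun i _ => ?_
  rw [Finset.sum_comm]
  refine Finset.sum_eq_zero fun k _ => ?_
  rw [← mul_zero (w i * w k * f i k), ← h i k, Finset.mul_sum]
  exact Finset.sum_congr rfl fun j _ => by ring

theorem kill3 (f : I → I → ℚ) (g : I → I → I → ℚ) (h : ∀ i j, ∑ k, w k * g i j k = 0) :
    ∑ i, ∑ j, ∑ k, w i * w j * w k * (g i j k * f i j) = 0 := by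
  refine Finset.sum_eq_zero fun i _ => ?_
  refine Finset.sum_eq_zero fun j _ => ?_
  rw [← mul_zero (w i * w j * f i j), ← h i j, Finset.mul_sum]
  exact Finset.sum_congr rfl fun k _ => by ring

theorem L9 (W : ℚ) (hW : ∑ i, w i = W) (x y1 y2 y3 z1 z2 z3 : I → I → ℚ) (hx : ZS w x)
    (hy1 : ZS w y1) (hy2 : ZS w y2) (hz1 : ZS w z1) (hz3 : ZS w z3) :
    ∑ i, ∑ j, ∑ k, w i * w j * w k *
      (x i j * (y1 j k + y2 k i + y3 i j) * (z1 k i + z2 i j + z3 j k)) =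
    Cf w x y1 z1 + Bf w x y2 z3 + W * Mo w x y3 z2 := by
  have e1 := kill3 w (fun i j => x i j * z2 i j) (fun _ j k => y1 j k) (fun _ j => hy1.2 j)
  have e2 := kill1 w (fun j k => y1 j k * z3 j k) (fun i j _ => x i j) (fun j _ => hx.1 j)
  have e3 := kill2 w (fun i k => y2 k i * z1 k i) (fun i j _ => x i j) (fun i _ => hx.2 i)
  have e4 := kill3 w (fun i j => x i j * z2 i j) (fun i _ k => y2 k i) (fun i _ => hy2.1 i)
  have e5 := kill3 w (fun i j => x i j * y3 i j) (fun i _ k => z1 k i) (fun i _ => hz1.1 i)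
  have e6 := kill3 w (fun i j => x i j * y3 i j) (fun _ j k => z3 j k) (fun _ j => hz3.2 j)
  have e7 : ∑ i, ∑ j, ∑ k, w i * w j * w k * (x i j * y3 i j * z2 i j) = W * Mo w x y3 z2 := by
    rw [Mo, Finset.mul_sum]
    refine Finset.sum_congr rfl fun i _ => ?_
    rw [Finset.mul_sum]
    refine Finset.sum_congr rfl fun j _ => ?_
    rw [← hW, Finset.sum_mul]
    exact Finset.sum_congr rfl fun k _ => by ring
  rw [← e7, ← add_zero (Cf w x y1 z1)]
  nth_rewrite 1 [← e1]
  rw [← add_zero (Cf w x y1 z1 + _)]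
  nth_rewrite 1 [← e2]
  rw [← add_zero (Cf w x y1 z1 + _ + _)]
  nth_rewrite 1 [← e3]
  rw [← add_zero (Cf w x y1 z1 + _ + _ + _)]
  nth_rewrite 1 [← e4]
  rw [← add_zero (Cf w x y1 z1 + _ + _ + _ + _)]
  nth_rewrite 1 [← e5]
  rw [← add_zero (Cf w x y1 z1 + _ + _ + _ + _ + _)]
  nth_rewrite 1 [← e6]
  simp only [Cf, Bf, ← Finset.sum_add_distrib]
  refine Finset.sum_congr rfl fun i _ => Finset.sum_congr rfl fun j _ =>
    Finset.sum_congr rfl fun k _ => by ring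

theorem L27 (W : ℚ) (hW : ∑ i, w i = W) (x1 x2 x3 y1 y2 y3 z1 z2 z3 : I → I → ℚ)
    (hx1 : ZS w x1) (hx2 : ZS w x2) (hx3 : ZS w x3)
    (hy1 : ZS w y1) (hy2 : ZS w y2) (hy3 : ZS w y3)
    (hz1 : ZS w z1) (hz2 : ZS w z2) (hz3 : ZS w z3) :
    ∑ i, ∑ j, ∑ k, w i * w j * w k *
      ((x1 i j + x2 j k + x3 k i) * (y1 j k + y2 k i + y3 i j) * (z1 k i + z2 i j + z3 j k)) =
    Cf w x1 y1 z1 + Cf w x2 y2 z2 + Cf w x3 y3 z3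
    + (Bf w x1 y2 z3 + Bf w x2 y3 z1 + Bf w x3 y1 z2)
    + W * (Mo w x1 y3 z2 + Mo w x2 y1 z3 + Mo w x3 y2 z1) := by
  have a1 := L9 w W hW x1 y1 y2 y3 z1 z2 z3 hx1 hy1 hy2 hz1 hz3
  have a2 := L9 w W hW x2 y2 y3 y1 z2 z3 z1 hx2 hy2 hy3 hz2 hz1
  have a3 := L9 w W hW x3 y3 y1 y2 z3 z1 z2 hx3 hy3 hy1 hz3 hz2
  rw [rot, rot] at a2
  rw [rot] at a3
  calc _ = _ := ?_
    _ = _ := congrArg₂ (· + ·) (congrArg₂ (· + ·) a1 a2) a3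
    _ = _ := by ring
  simp only [← Finset.sum_add_distrib]
  refine Finset.sum_congr rfl fun i _ => Finset.sum_congr rfl fun j _ =>
    Finset.sum_congr rfl fun k _ => by ring

theorem ZS.smul {x : I → I → ℚ} (h : ZS w x) (q : ℚ) : ZS w (fun i j => q * x i j) := by
  constructor
  · intro j
    rw [← mul_zero q, ← h.1 j, Finset.mul_sum]
    exact Finset.sum_congr rfl fun _ _ => by ring
  · intro j
    rw [← mul_zero q, ← h.2 j, Finset.mul_sum]
    exact Finset.sum_congr rfl fun _ _ => by ring

theorem Cf_smul (p q r : ℚ) (x y z : I → I → ℚ) :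
    Cf w (fun i j => p * x i j) (fun i j => q * y i j) (fun i j => r * z i j)
      = p * q * r * Cf w x y z := by
  simp only [Cf, Finset.mul_sum]
  refine Finset.sum_congr rfl fun i _ => Finset.sum_congr rfl fun j _ =>
    Finset.sum_congr rfl fun k _ => by ring

theorem Bf_smul (p q r : ℚ) (x y z : I → I → ℚ) :
    Bf w (fun i j => p * x i j) (fun i j => q * y i j) (fun i j => r * z i j)
      = p * q * r * Bf w x y z := by
  simp only [Bf, Finset.mul_sum]
  refine Finset.sum_congr rfl fun i _ => Finset.sum_congr rfl fun j _ =>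
    Finset.sum_congr rfl fun k _ => by ring

theorem Mo_smul (p q r : ℚ) (x y z : I → I → ℚ) :
    Mo w (fun i j => p * x i j) (fun i j => q * y i j) (fun i j => r * z i j)
      = p * q * r * Mo w x y z := by
  simp only [Mo, Finset.mul_sum]
  refine Finset.sum_congr rfl fun i _ => Finset.sum_congr rfl fun j _ => by ring

/-- The aggregate. -/
def Agg (a b c : Bool → Bool → I → I → ℚ) (α β γ : Bool) (i j k : I) : ℚ :=
  (sg β * sg γ * a α β i j + sg α * sg β * a γ α j k + sg γ * sg α * a β γ k i) *
  (sg γ * sg α * b β γ j k + sg β * sg γ * b α β k i + sg α * sg β * b γ α i j) *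
  (sg α * sg β * c γ α k i + sg γ * sg α * c β γ i j + sg β * sg γ * c α β j k)

def Gf (a b c : Bool → Bool → I → I → ℚ) (i j k : I) : ℚ :=
  ∑ α, ∑ β, ∑ γ, Agg a b c α β γ i j k

theorem Gf_rot (a b c : Bool → Bool → I → I → ℚ) (i j k : I) :
    Gf a b c j k i = Gf a b c i j k := by
  have h : ∀ α β γ, Agg a b c α β γ j k i = Agg a b c β γ α i j k := by
    intro α β γ
    unfold Agg
    ring
  simp only [Gf, h, Fintype.sum_bool]
  ring

theorem Gf_diag (a b c : Bool → Bool → I → I → ℚ) (i : I) :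
    Gf a b c i i i = 3 * Af (fun α β => a α β i i) (fun α β => b α β i i) (fun α β => c α β i i) := by
  simp only [Gf, Agg, Af, Fintype.sum_bool, sg_true, sg_false]
  ring

theorem sum_Gf (W : ℚ) (hW : ∑ i, w i = W) (a b c : Bool → Bool → I → I → ℚ)
    (ha : ∀ α β, ZS w (a α β)) (hb : ∀ α β, ZS w (b α β)) (hc : ∀ α β, ZS w (c α β)) :
    ∑ i, ∑ j, ∑ k, w i * w j * w k * Gf a b c i j k =
      3 * (∑ α, ∑ β, ∑ γ, Cf w (a α β) (b β γ) (c γ α)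
        + W * ∑ i, ∑ j, w i * w j * Mf (fun α β => a α β i j) (fun α β => b α β i j)
          (fun α β => c α β i j)) := by
  have h : ∀ α β γ, ∑ i, ∑ j, ∑ k, w i * w j * w k * Agg a b c α β γ i j k = _ :=
    fun α β γ => L27 w W hW _ _ _ _ _ _ _ _ _
      ((ha α β).smul w (sg β * sg γ)) ((ha γ α).smul w (sg α * sg β))
      ((ha β γ).smul w (sg γ * sg α))
      ((hb β γ).smul w (sg γ * sg α)) ((hb α β).smul w (sg β * sg γ))
      ((hb γ α).smul w (sg α * sg β))
      ((hc γ α).smul w (sg α * sg β)) ((hc β γ).smul w (sg γ * sg α))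
      ((hc α β).smul w (sg β * sg γ))
  have hM : ∑ i, ∑ j, w i * w j * Mf (fun α β => a α β i j) (fun α β => b α β i j)
          (fun α β => c α β i j) = ∑ α, ∑ β, ∑ γ, Mo w (a α β) (b γ α) (c β γ) := by
    simp only [Mf, Mo, Fintype.sum_bool, ← Finset.sum_add_distrib]
    refine Finset.sum_congr rfl fun i _ => Finset.sum_congr rfl fun j _ => by ring
  have hG : ∑ i, ∑ j, ∑ k, w i * w j * w k * Gf a b c i j k =
      ∑ α, ∑ β, ∑ γ, ∑ i, ∑ j, ∑ k, w i * w j * w k * Agg a b c α β γ i j k := by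
    simp only [Gf, Fintype.sum_bool, ← Finset.sum_add_distrib]
    refine Finset.sum_congr rfl fun i _ => Finset.sum_congr rfl fun j _ =>
      Finset.sum_congr rfl fun k _ => by ring
  rw [hG, hM]
  simp only [h, Cf_smul, Bf_smul, Mo_smul, Fintype.sum_bool, sg_true, sg_false]
  ring

end core

section orbit

/-- Representatives of the nonconstant triples modulo rotation. -/
def SS (p : ℕ) : Finset (Fin p × Fin p × Fin p) :=
  Finset.univ.filter fun t => t.1 < t.2.1 ∧ t.1 ≤ t.2.2

theorem orbit_sum {p : ℕ} (F : Fin p → Fin p → Fin p → ℚ) (hF : ∀ i j k, F j k i = F i j k) :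
    ∑ i, ∑ j, ∑ k, F i j k = 3 * ∑ t ∈ SS p, F t.1 t.2.1 t.2.2 + ∑ i, F i i i := by
  have h1 : ∑ t ∈ SS p, F t.1 t.2.1 t.2.2
      = ∑ i, ∑ j, ∑ k, if i < j ∧ i ≤ k then F i j k else 0 := by
    rw [SS, Finset.sum_filter, Fintype.sum_prod_type]
    refine Finset.sum_congr rfl fun i _ => ?_
    rw [Fintype.sum_prod_type]
  have h2 := h1
  rw [rot] at h2
  have h3 := h2
  rw [rot] at h3
  have h4 : ∑ i, F i i i = ∑ i, ∑ j, ∑ k, if i = j ∧ i = k then F i j k else 0 := by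
    refine Finset.sum_congr rfl fun i _ => ?_
    rw [Finset.sum_eq_single i, Finset.sum_eq_single i]
    · simp
    · intro b _ hb
      simp [Ne.symm hb]
    · simp
    · intro b _ hb
      simp [Ne.symm hb]
    · simp
  have h5 : 3 * ∑ t ∈ SS p, F t.1 t.2.1 t.2.2 + ∑ i, F i i i =
      ((∑ t ∈ SS p, F t.1 t.2.1 t.2.2 + ∑ t ∈ SS p, F t.1 t.2.1 t.2.2)
        + ∑ t ∈ SS p, F t.1 t.2.1 t.2.2) + ∑ i, F i i i := by ring
  rw [h5, h4]
  nth_rewrite 1 [h1]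
  nth_rewrite 1 [h2]
  rw [h3]
  simp only [← Finset.sum_add_distrib]
  refine Finset.sum_congr rfl fun i _ => Finset.sum_congr rfl fun j _ =>
    Finset.sum_congr rfl fun k _ => ?_
  rw [hF i j k, ← hF k i j]
  have e : ∀ (P : Prop) [Decidable P] (q : ℚ), (if P then q else 0) = (if P then 1 else 0) * q := by
    intro P _ q
    split_ifs <;> simp
  rw [e (i < j ∧ i ≤ k), e (k < i ∧ k ≤ j), e (j < k ∧ j ≤ i), e (i = j ∧ i = k), ← add_mul,
    ← add_mul, ← add_mul]
  have : ((if i < j ∧ i ≤ k then 1 else 0) + (if k < i ∧ k ≤ j then 1 else 0)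
    + (if j < k ∧ j ≤ i then 1 else 0) + (if i = j ∧ i = k then 1 else 0) : ℚ) = 1 := by
    split_ifs <;> first | (exfalso; omega) | norm_num
  rw [this, one_mul]

theorem card_SS (p : ℕ) : 3 * (SS p).card + p = p ^ 3 := by
  have := orbit_sum (p := p) (fun _ _ _ => 1) (fun _ _ _ => rfl)
  simp at this
  have h : ((3 * (SS p).card + p : ℕ) : ℚ) = ((p ^ 3 : ℕ) : ℚ) := by
    push_cast
    linarith
  exact_mod_cast h

theorem main_rank {V : Type} [AddCommGroup V] [Module ℚ V] {p : ℕ} (w : Fin p → ℚ)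
    (hW : ∑ i, w i = 9) (l : Bool → Bool → Fin p → Fin p → (V →ₗ[ℚ] ℚ))
    (hl : ∀ v α β, ZS w (fun i j => l α β i j v)) :
    Rk (fun a b c => ∑ α, ∑ β, ∑ γ, Cf w (fun i j => l α β i j a) (fun i j => l β γ i j b)
      (fun i j => l γ α i j c))
      (8 * (SS p).card + ∑ i, (if w i = 1 then 7 else 11)
        + 7 * (Finset.univ.offDiag : Finset (Fin p × Fin p)).card) := by
  let E : V → Bool → Bool → Fin p → Fin p → ℚ := fun v α β i j => l α β i j v
  let m : Fin p → Fin p → V → V → V → ℚ := fun i j a b c =>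
    Mf (fun α β => l α β i j a) (fun α β => l α β i j b) (fun α β => l α β i j c)
  let d : Fin p → V → V → V → ℚ := fun i a b c =>
    Af (fun α β => l α β i i a) (fun α β => l α β i i b) (fun α β => l α β i i c)
  have rG : ∀ i j k, Rk (fun a b c => w i * w j * w k * Gf (E a) (E b) (E c) i j k) 8 := by
    intro i j k
    apply Rk.smul
    have : Rk (fun a b c => ∑ α ∈ (Finset.univ : Finset Bool), ∑ β ∈ (Finset.univ : Finset Bool),
        ∑ γ ∈ (Finset.univ : Finset Bool), Agg (E a) (E b) (E c) α β γ i j k)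
        (∑ α ∈ (Finset.univ : Finset Bool), ∑ β ∈ (Finset.univ : Finset Bool),
        ∑ γ ∈ (Finset.univ : Finset Bool), 1) := by
      refine Rk.sum _ (fun α a b c => ∑ β ∈ (Finset.univ : Finset Bool),
        ∑ γ ∈ (Finset.univ : Finset Bool), Agg (E a) (E b) (E c) α β γ i j k) _ fun α _ => ?_
      refine Rk.sum _ (fun β a b c => 
        ∑ γ ∈ (Finset.univ : Finset Bool), Agg (E a) (E b) (E c) α β γ i j k) _ fun β _ => ?_
      refine Rk.sum _ (fun γ a b c => Agg (E a) (E b) (E c) α β γ i j k) _ fun γ _ => ?_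
      refine (Rk.one
        ((sg β * sg γ) • l α β i j + (sg α * sg β) • l γ α j k + (sg γ * sg α) • l β γ k i)
        ((sg γ * sg α) • l β γ j k + (sg β * sg γ) • l α β k i + (sg α * sg β) • l γ α i j)
        ((sg α * sg β) • l γ α k i + (sg γ * sg α) • l β γ i j + (sg β * sg γ) • l α β j k)).congr
        fun a b c => ?_
      simp only [Agg, E, LinearMap.add_apply, LinearMap.smul_apply, smul_eq_mul]
    simpa [Gf] using this
  have r1 := Rk.sum (SS p) (fun t a b c => w t.1 * w t.2.1 * w t.2.2 *
    Gf (E a) (E b) (E c) t.1 t.2.1 t.2.2) (fun _ => 8) (fun t _ => rG _ _ _)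
  have r2 := Rk.sum (Finset.univ : Finset (Fin p))
    (fun i a b c => w i ^ 3 * d i a b c + (-9 * w i ^ 2) * m i i a b c)
    (fun i => if w i = 1 then 7 else 11) (by
      intro i _
      split_ifs with h
      · refine (rk_diag fun α β => l α β i i).congr fun a b c => ?_
        rw [h]
        simp only [d, m]
        ring
      · exact ((rk_Af fun α β => l α β i i).smul _).add ((rk_Mf fun α β => l α β i i).smul _))
  have r3 := Rk.sum (Finset.univ.offDiag : Finset (Fin p × Fin p))
    (fun t a b c => (-9 * (w t.1 * w t.2)) * m t.1 t.2 a b c) (fun _ => 7)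
    (fun t _ => (rk_Mf fun α β => l α β t.1 t.2).smul _)
  have r := (r1.add r2).add r3
  simp only [Finset.sum_const, smul_eq_mul] at r
  rw [mul_comm 8, mul_comm 7]
  refine r.congr fun a b c => ?_
  have k1 := sum_Gf w 9 hW (E a) (E b) (E c) (hl a) (hl b) (hl c)
  rw [orbit_sum (fun i j k => w i * w j * w k * Gf (E a) (E b) (E c) i j k) (by
    intro i j k
    rw [Gf_rot]
    ring)] at k1
  have k2 : ∑ i, w i * w i * w i * Gf (E a) (E b) (E c) i i i = 3 * ∑ i, w i ^ 3 * d i a b c := by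
    rw [Finset.mul_sum]
    refine Finset.sum_congr rfl fun i _ => ?_
    rw [Gf_diag]
    simp only [d, E]
    ring
  have k3 : ∑ i, ∑ j, w i * w j * m i j a b c
      = ∑ i, w i ^ 2 * m i i a b c
        + ∑ t ∈ (Finset.univ.offDiag : Finset (Fin p × Fin p)), w t.1 * w t.2 * m t.1 t.2 a b c := by
    rw [← Fintype.sum_prod_type' (fun i j => w i * w j * m i j a b c), ← Finset.univ_product_univ,
      ← Finset.diag_union_offDiag, Finset.sum_union (Finset.disjoint_diag_offDiag _),
      Finset.sum_diag]
    congr 1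
    exact Finset.sum_congr rfl fun i _ => by ring
  rw [k2] at k1
  have k4 : ∑ t ∈ (Finset.univ.offDiag : Finset (Fin p × Fin p)),
      (-9 * (w t.1 * w t.2)) * m t.1 t.2 a b c =
      -9 * ∑ t ∈ (Finset.univ.offDiag : Finset (Fin p × Fin p)),
        w t.1 * w t.2 * m t.1 t.2 a b c := by
    rw [Finset.mul_sum]
    exact Finset.sum_congr rfl fun i _ => by ring
  have k5 : ∑ i, (w i ^ 3 * d i a b c + (-9 * w i ^ 2) * m i i a b c)
      = ∑ i, w i ^ 3 * d i a b c - 9 * ∑ i, w i ^ 2 * m i i a b c := by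
    rw [Finset.mul_sum, ← Finset.sum_sub_distrib]
    exact Finset.sum_congr rfl fun i _ => by ring
  rw [k4, k5]
  have k6 := k1
  change _ = 3 * (_ + 9 * ∑ i, ∑ j, w i * w j * m i j a b c) at k6
  rw [k3] at k6
  simp only [E] at k6 ⊢
  linarith

end orbit

section embed

theorem trace_blk {n ι : Type} [Fintype n] [Fintype ι] [DecidableEq n] [DecidableEq ι]
    (A B C : Matrix (n × ι) (n × ι) ℚ) :
    (A * B * C).trace = ∑ α, ∑ β, ∑ γ,
      ((Matrix.of fun i j => A (i, α) (j, β)) * (Matrix.of fun i j => B (i, β) (j, γ))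
        * (Matrix.of fun i j => C (i, γ) (j, α)) : Matrix n n ℚ).trace := by
  simp only [Matrix.trace, Matrix.diag_apply, Matrix.mul_apply, Fintype.sum_prod_type,
    Matrix.of_apply, Finset.sum_mul]
  rw [Finset.sum_comm]
  refine Finset.sum_congr rfl fun α _ => ?_
  have h1 : ∀ i : n, (∑ k : n, ∑ γ : ι, ∑ j : n, ∑ β : ι,
      A (i, α) (j, β) * B (j, β) (k, γ) * C (k, γ) (i, α))
      = ∑ β : ι, ∑ γ : ι, ∑ k : n, ∑ j : n, A (i, α) (j, β) * B (j, β) (k, γ) * C (k, γ) (i, α) := by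
    intro i
    rw [Finset.sum_comm]
    conv_rhs => rw [Finset.sum_comm]
    refine Finset.sum_congr rfl fun γ _ => ?_
    conv_rhs => rw [Finset.sum_comm]
    refine Finset.sum_congr rfl fun k _ => ?_
    exact Finset.sum_comm
  simp only [h1]
  rw [Finset.sum_comm]
  refine Finset.sum_congr rfl fun β _ => ?_
  rw [Finset.sum_comm]

theorem Cf_trace {I : Type} [Fintype I] [DecidableEq I] (w : I → ℚ) (X Y Z : Matrix I I ℚ) :
    Cf w (fun i j => X i j) (fun i j => Y i j) (fun i j => Z i j)
      = (X * Matrix.diagonal w * Y * Matrix.diagonal w * Z * Matrix.diagonal w).trace := by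
  simp only [Cf, Matrix.trace, Matrix.diag_apply, Matrix.mul_diagonal]
  refine Finset.sum_congr rfl fun i _ => ?_
  rw [Matrix.mul_apply, Finset.sum_mul, Finset.sum_comm]
  refine Finset.sum_congr rfl fun k _ => ?_
  rw [Matrix.mul_diagonal, Matrix.mul_apply, Finset.sum_mul, Finset.sum_mul, Finset.sum_mul]
  refine Finset.sum_congr rfl fun j _ => ?_
  rw [Matrix.mul_diagonal]
  ring

/-- Trace form. -/
def trf (n : Type) [Fintype n] (A B C : Matrix n n ℚ) : ℚ := (A * B * C).trace

theorem rk_embed {s : ℕ} (w : Fin (s + 1) → ℚ) (hw : ∀ i, w i ≠ 0) (hW : ∑ i, w i = 9) :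
    Rk (trf (Fin s × Bool)) (8 * (SS (s + 1)).card + ∑ i, (if w i = 1 then 7 else 11)
        + 7 * (Finset.univ.offDiag : Finset (Fin (s + 1) × Fin (s + 1))).card) := by
  let E : Matrix (Fin (s + 1)) (Fin s) ℚ := Matrix.of fun i r =>
    (if i = r.succ then 1 else 0) - (if i = 0 then w r.succ / w 0 else 0)
  let F : Matrix (Fin s) (Fin (s + 1)) ℚ := Matrix.of fun r i =>
    (if i = r.succ then (w r.succ)⁻¹ else 0) - 1 / 9
  have hE : ∀ r, ∑ i, w i * E i r = 0 := by
    intro r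
    simp only [E, Matrix.of_apply, mul_sub, Finset.sum_sub_distrib, mul_ite, mul_one, mul_zero,
      Finset.sum_ite_eq', Finset.mem_univ, if_true]
    field_simp [hw 0]
    simp
  have hF : ∀ r, ∑ j, w j * F r j = 0 := by
    intro r
    simp only [F, Matrix.of_apply, mul_sub, Finset.sum_sub_distrib, mul_ite, mul_zero,
      Finset.sum_ite_eq', Finset.mem_univ, if_true]
    rw [← Finset.sum_mul, hW, mul_inv_cancel₀ (hw _)]
    norm_num
  have hFDE : F * Matrix.diagonal w * E = 1 := by
    ext r r'
    rw [Matrix.mul_apply]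
    have : ∀ i, (F * Matrix.diagonal w) r i * E i r' =
        (if i = r.succ then E i r' else 0) - 1 / 9 * (w i * E i r') := by
      intro i
      rw [Matrix.mul_diagonal]
      simp only [F, Matrix.of_apply]
      split_ifs with h
      · rw [h]
        have := hw r.succ
        field_simp
      · ring
    simp only [this, Finset.sum_sub_distrib, ← Finset.mul_sum, hE, mul_zero, sub_zero,
      Finset.sum_ite_eq', Finset.mem_univ, if_true]
    simp [E, Matrix.one_apply, Fin.succ_ne_zero]
  let l : Bool → Bool → Fin (s + 1) → Fin (s + 1) → (Matrix (Fin s × Bool) (Fin s × Bool) ℚ →ₗ[ℚ] ℚ) :=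
    fun α β i j =>
    { toFun := fun A => (E * (Matrix.of fun i j => A (i, α) (j, β)) * F) i j
      map_add' := by
        intro A B
        rw [← Matrix.add_apply, ← Matrix.add_mul, ← Matrix.mul_add]
        rfl
      map_smul' := by
        intro q A
        rw [RingHom.id_apply, ← Matrix.smul_apply, ← Matrix.smul_mul, ← Matrix.mul_smul]
        rfl }
  refine (main_rank w hW l ?_).congr ?_
  · intro A α β
    constructor
    · intro j
      change ∑ i, w i * (E * (Matrix.of fun i j => A (i, α) (j, β)) * F) i j = 0
      rw [Matrix.mul_assoc]
      simp only [Matrix.mul_apply (M := E), Finset.mul_sum]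
      rw [Finset.sum_comm]
      refine Finset.sum_eq_zero fun r _ => ?_
      simp only [← mul_assoc]
      rw [← Finset.sum_mul, hE, zero_mul]
    · intro i
      change ∑ j, w j * (E * (Matrix.of fun i j => A (i, α) (j, β)) * F) i j = 0
      simp only [Matrix.mul_apply (N := F), Finset.mul_sum]
      rw [Finset.sum_comm]
      refine Finset.sum_eq_zero fun r _ => ?_
      simp only [mul_left_comm (w _)]
      rw [← Finset.mul_sum, hF, mul_zero]
  · intro A B C
    rw [trf, trace_blk]
    refine Finset.sum_congr rfl fun α _ => Finset.sum_congr rfl fun β _ =>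
      Finset.sum_congr rfl fun γ _ => ?_
    refine Eq.trans ?_ (Cf_trace w (E * (Matrix.of fun i j => A (i, α) (j, β)) * F)
      (E * (Matrix.of fun i j => B (i, β) (j, γ)) * F)
      (E * (Matrix.of fun i j => C (i, γ) (j, α)) * F)).symm
    generalize (Matrix.of fun i j => A (i, α) (j, β) : Matrix (Fin s) (Fin s) ℚ) = a
    generalize (Matrix.of fun i j => B (i, β) (j, γ) : Matrix (Fin s) (Fin s) ℚ) = b
    generalize (Matrix.of fun i j => C (i, γ) (j, α) : Matrix (Fin s) (Fin s) ℚ) = c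
    have : E * a * F * diagonal w * (E * b * F) * diagonal w * (E * c * F) * diagonal w
      = E * (a * (F * diagonal w * E) * b * (F * diagonal w * E) * c * (F * diagonal w)) := by
      simp only [Matrix.mul_assoc]
    rw [this, Matrix.trace_mul_comm E, hFDE, Matrix.mul_one, Matrix.mul_one, Matrix.mul_assoc _ _ E,
      hFDE, Matrix.mul_one]

theorem rk_sq {n : Type} [Fintype n] [DecidableEq n] {r : ℕ} (h : Rk (trf n) r) :
    Rk (trf (n × n)) (r * r) := by
  obtain ⟨f, g, k, H⟩ := h
  let bl : n → n → Matrix (n × n) (n × n) ℚ →ₗ[ℚ] Matrix n n ℚ := fun α β =>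
    { toFun := fun A => Matrix.of fun i j => A (i, α) (j, β)
      map_add' := fun A B => rfl
      map_smul' := fun q A => rfl }
  let T : (Matrix n n ℚ →ₗ[ℚ] ℚ) → Matrix (n × n) (n × n) ℚ →ₗ[ℚ] Matrix n n ℚ := fun φ =>
    { toFun := fun A => Matrix.of fun α β => φ (bl α β A)
      map_add' := fun A B => by ext; simp
      map_smul' := fun q A => by ext; simp }
  have h1 : ∀ i, Rk (fun A B C => trf n (T (f i) A) (T (g i) B) (T (k i) C)) r := by
    intro i
    exact ⟨fun j => (f j).comp (T (f i)), fun j => (g j).comp (T (g i)),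
      fun j => (k j).comp (T (k i)), fun A B C => H _ _ _⟩
  have h2 := Rk.sum Finset.univ (fun i A B C => trf n (T (f i) A) (T (g i) B) (T (k i) C))
    (fun _ => r) (fun i _ => h1 i)
  simp only [Finset.sum_const, Finset.card_univ, Fintype.card_fin, smul_eq_mul] at h2
  refine h2.congr fun A B C => ?_
  rw [trf, trace_blk]
  have h3 : ∀ α β γ, ((Matrix.of fun i j => A (i, α) (j, β)) * (Matrix.of fun i j => B (i, β) (j, γ))
        * (Matrix.of fun i j => C (i, γ) (j, α)) : Matrix n n ℚ).trace =
        ∑ i, f i (bl α β A) * g i (bl β γ B) * k i (bl γ α C) := fun α β γ => H _ _ _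
  simp only [h3]
  have h4 : ∀ i, trf n (T (f i) A) (T (g i) B) (T (k i) C) =
      ∑ α, ∑ β, ∑ γ, f i (bl α β A) * g i (bl β γ B) * k i (bl γ α C) := by
    intro i
    simp only [trf, Matrix.trace, Matrix.diag_apply, Matrix.mul_apply, Finset.sum_mul]
    refine Finset.sum_congr rfl fun α _ => ?_
    rw [Finset.sum_comm]
    rfl
  simp only [h4]
  symm
  rw [Finset.sum_comm]
  refine Finset.sum_congr rfl fun α _ => ?_
  rw [Finset.sum_comm]
  refine Finset.sum_congr rfl fun β _ => ?_
  rw [Finset.sum_comm]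

theorem rk_equiv {n n' : Type} [Fintype n] [Fintype n'] (e : n' ≃ n) {r : ℕ} (h : Rk (trf n) r) :
    Rk (trf n') r := by
  obtain ⟨f, g, k, H⟩ := h
  let L : Matrix n' n' ℚ →ₗ[ℚ] Matrix n n ℚ :=
    { toFun := fun A => A.submatrix e.symm e.symm
      map_add' := fun A B => rfl
      map_smul' := fun q A => rfl }
  refine ⟨fun i => (f i).comp L, fun i => (g i).comp L, fun i => (k i).comp L, fun A B C => ?_⟩
  refine Eq.trans ?_ (H (L A) (L B) (L C))
  change (A * B * C).trace = (A.submatrix e.symm e.symm * B.submatrix e.symm e.symm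
    * C.submatrix e.symm e.symm).trace
  rw [Matrix.submatrix_mul_equiv, Matrix.submatrix_mul_equiv]
  simp only [Matrix.trace, Matrix.diag_apply, Matrix.submatrix_apply]
  exact (Equiv.sum_comp e.symm (fun i => (A * B * C) i i)).symm

theorem rk_naive (n : ℕ) : Rk (trf (Fin n)) (n ^ 3) := by
  let en : Fin n → Fin n → Matrix (Fin n) (Fin n) ℚ →ₗ[ℚ] ℚ := fun i j =>
    { toFun := fun A => A i j
      map_add' := fun A B => rfl
      map_smul' := fun q A => rfl }
  have := Rk.sum (Finset.univ : Finset (Fin n × Fin n × Fin n))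
    (fun t A B C => en t.1 t.2.2 A * en t.2.2 t.2.1 B * en t.2.1 t.1 C) (fun _ => 1)
    (fun t _ => Rk.one _ _ _)
  have hc : ∑ _t : Fin n × Fin n × Fin n, 1 = n ^ 3 := by
    simp
    ring
  rw [hc] at this
  refine this.congr fun A B C => ?_
  simp only [trf, Matrix.trace, Matrix.diag_apply, Matrix.mul_apply, Fintype.sum_prod_type,
    Finset.sum_mul]
  rfl

end embed

end TA

theorem TA.alg_of_rk {N t : ℕ} (h : TA.Rk (TA.trf (Fin N)) t) :
    ∃ (U V W : Matrix (Fin t) (Fin (N * N)) ℚ), IsMMAlg N N N t U V W := by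
  obtain ⟨f, g, k, H⟩ := h
  have key : ∀ (φ : Fin t → Matrix (Fin N) (Fin N) ℚ →ₗ[ℚ] ℚ) (A : Matrix (Fin N) (Fin N) ℚ) r,
      (Matrix.of fun r (q : Fin (N * N)) => φ r (Matrix.single q.divNat q.modNat 1)).mulVec (_root_.vec A) r
        = φ r A := by
    intro φ A r
    conv_rhs => rw [Matrix.matrix_eq_sum_single A]
    simp only [map_sum, Matrix.mulVec, dotProduct, _root_.vec, Matrix.of_apply]
    rw [← Equiv.sum_comp finProdFinEquiv, Fintype.sum_prod_type]
    refine Finset.sum_congr rfl fun i _ => Finset.sum_congr rfl fun j _ => ?_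
    have h1 : (finProdFinEquiv (i, j)).divNat = i := congrArg Prod.fst (finProdFinEquiv.symm_apply_apply (i, j))
    have h2 : (finProdFinEquiv (i, j)).modNat = j := congrArg Prod.snd (finProdFinEquiv.symm_apply_apply (i, j))
    rw [h1, h2]
    have h3 : Matrix.single i j (A i j) = A i j • Matrix.single i j (1 : ℚ) := by
      simp [Matrix.smul_single]
    rw [h3, map_smul, smul_eq_mul, mul_comm]
  refine ⟨Matrix.of fun r q => f r (Matrix.single q.divNat q.modNat 1),
    Matrix.of fun r q => g r (Matrix.single q.divNat q.modNat 1),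
    Matrix.of fun r q => k r (Matrix.single q.divNat q.modNat 1), fun A B C => ?_⟩
  simp only [key]
  exact H A B C


theorem TA.rk_weights (s : ℕ) (x y : ℚ) (hx : x ≠ 0) (hy : y ≠ 0) (hxy : x + y + s = 9) :
    TA.Rk (TA.trf (Fin (s + 1) × Bool)) (8 * (TA.SS (s + 2)).card +
      ((if x = 1 then 7 else 11) + (if y = 1 then 7 else 11) + 7 * s)
        + 7 * ((s + 2) * (s + 2) - (s + 2))) := by
  have := TA.rk_embed (s := s + 1) (Fin.cons x (Fin.cons y fun _ => 1)) (by
    intro i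
    refine Fin.cases ?_ (fun i => ?_) i
    · simpa using hx
    · refine Fin.cases ?_ (fun i => ?_) i
      · simpa using hy
      · simp) (by
    rw [Fin.sum_univ_succ, Fin.sum_univ_succ]
    simp
    linarith)
  rw [Fin.sum_univ_succ, Fin.sum_univ_succ, Finset.offDiag_card] at this
  simp only [Fin.cons_zero, Fin.cons_succ, if_true, Finset.sum_const, Finset.card_univ,
    Fintype.card_fin, smul_eq_mul] at this
  refine this.mono (le_of_eq ?_)
  ring_nf

theorem TA.rk_final (s : ℕ) (hs : 3 ≤ s) : ∃ r, TA.Rk (TA.trf (Fin (s + 1) × Bool)) r ∧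
    (r ≤ 8 * (TA.SS (s + 2)).card + 7 * (s + 2) ^ 2 + 4 ∨
      (s = 8 ∧ r ≤ 8 * (TA.SS (s + 2)).card + 7 * (s + 2) ^ 2 + 8)) := by
  have e : (s + 2) * (s + 2) - (s + 2) = s * s + 3 * s + 2 := by
    rw [Nat.sub_eq_iff_eq_add (by nlinarith)]
    ring
  by_cases h8 : s = 8
  · have := TA.rk_weights s 2 (-1) (by norm_num) (by norm_num) (by rw [h8]; norm_num)
    refine ⟨_, this, Or.inr ⟨h8, ?_⟩⟩
    rw [e]
    split_ifs <;> nlinarith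
  · have := TA.rk_weights s (8 - s) 1 (by
      intro h
      apply h8
      have : (s : ℚ) = 8 := by linarith
      exact_mod_cast this) (by norm_num) (by ring)
    refine ⟨_, this, Or.inl ?_⟩
    rw [e, if_pos (rfl : (1 : ℚ) = 1)]
    split_ifs <;> nlinarith

/-- The family `TA-New25b`: for every even `m₀ ≥ 2`, `m₀ ≠ 16`, with `n₀ = m₀²`, there is an
`⟨n₀,n₀,n₀;t⟩`-algorithm over `ℚ` where
`36 * t = 4m₀⁶ + 90m₀⁵ + 748m₀⁴ + 2928m₀³ + 5872m₀² + 5856m₀ + 2304`. -/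
theorem ta_new25b_exists (m₀ : ℕ) (h2 : 2 ≤ m₀) (heven : Even m₀) (h16 : m₀ ≠ 16)
    (t : ℕ)
    (ht : 36 * t = 4 * m₀ ^ 6 + 90 * m₀ ^ 5 + 748 * m₀ ^ 4 + 2928 * m₀ ^ 3 +
      5872 * m₀ ^ 2 + 5856 * m₀ + 2304) :
    ∃ (U V W : Matrix (Fin t) (Fin (m₀ ^ 2 * m₀ ^ 2)) ℚ),
      IsMMAlg (m₀ ^ 2) (m₀ ^ 2) (m₀ ^ 2) t U V W := by
  apply TA.alg_of_rk
  obtain ⟨s', hs'⟩ := heven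
  obtain ⟨s, rfl⟩ : ∃ s, s' = s + 1 := ⟨s' - 1, by omega⟩
  subst hs'
  by_cases hs : 3 ≤ s
  · obtain ⟨r, hr, hle⟩ := TA.rk_final s hs
    have e1 : Fin ((s + 1 + (s + 1)) ^ 2) ≃ (Fin (s + 1) × Bool) × (Fin (s + 1) × Bool) :=
      Fintype.equivOfCardEq (by simp; ring)
    refine (TA.rk_equiv e1 (TA.rk_sq hr)).mono ?_
    have hc := TA.card_SS (s + 2)
    obtain ⟨q, rfl⟩ := Nat.exists_eq_add_of_le hs
    generalize (TA.SS (3 + q + 2)).card = N at hle hc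
    have hN : 3 * N = q ^ 3 + 15 * q ^ 2 + 74 * q + 120 := by nlinarith
    rcases hle with hle | ⟨h8, hle⟩
    · have h3 : 3 * r ≤ 8 * (q ^ 3 + 15 * q ^ 2 + 74 * q + 120) + 21 * (3 + q + 2) ^ 2 + 12 := by
        nlinarith
      have h4 : (3 * r) * (3 * r) ≤ _ := Nat.mul_le_mul h3 h3
      have h5 : 36 * (r * r) ≤ 36 * t := by
        rw [ht]
        refine le_trans (by linarith) (le_trans (Nat.mul_le_mul_left 4 h4) ?_)
        ring_nf
        have : ∀ n : ℕ, 0 ≤ n := Nat.zero_le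
        nlinarith [this q, this (q ^ 2), this (q ^ 3), this (q ^ 4), this (q ^ 5)]
      omega
    · have : q = 5 := by omega
      subst this
      have hN' : N = 330 := by omega
      subst hN'
      have h3 : r ≤ 3348 := by omega
      have h4 : r * r ≤ 3348 * 3348 := Nat.mul_le_mul h3 h3
      omega
  · refine (TA.rk_naive _).mono ?_
    have : s = 0 ∨ s = 1 ∨ s = 2 := by omega
    rcases this with rfl | rfl | rfl <;> omega
end
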